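/- arXiv:2406.00688 — 2 statements merged into one kernel-verified Lean document; each statement's English description precedes it below -/
import Mathlib

section
/- There exist a finite ordered alphabet D and upper triangular endomorphisms g1, g2 of the free monoid D* such that, writing H for the submonoid of End(D*) generated by g1 and g2, o for the endomorphism of D* mapping every letter to the empty word, and φ for the monoid homomorphism from the free monoid {1,2}* to End(D*) sending 1 to g1 and 2 to g2, the set of pairs of words (u,v) over {1,2} for which there exists h ∈ H with φ(u) h = φ(v) h ≠ o is not a decidable (computable) predicate on pairs of words. -/
def IsUpperTriangular {α : Type} [LinearOrder α] (g : Monoid.End (FreeMonoid α)) : Prop :=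
  ∀ x y : α, y < x → y ∉ FreeMonoid.toList (g (FreeMonoid.of x))

/-- The endomorphism `o` mapping every letter (hence every word) to the empty word. -/
def oEnd (α : Type) : Monoid.End (FreeMonoid α) :=
  { toFun := fun _ => 1
    map_one' := rfl
    map_mul' := fun _ _ => (one_mul (1 : FreeMonoid α)).symm }

section
open Turing in
theorem tm0_restrict {Γ Λ : Type} [Inhabited Γ] [Inhabited Λ] (M : TM0.Machine Γ Λ) (S : Set Λ)
    (ss : TM0.Supports M S) :
    ∃ (_ : Inhabited S) (M' : TM0.Machine Γ S), ∀ l, (StateTransition.eval (TM0.step M') (TM0.init l)).Dom ↔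
      (TM0.eval M l).Dom := by
  classical
  let iS : Inhabited S := ⟨⟨default, ss.1⟩⟩
  refine ⟨iS, ?_⟩
  have hdef : ((default : S) : Λ) = default := rfl
  let f : PointedMap Γ Γ := ⟨id, rfl⟩
  let g₁ : PointedMap Λ S := ⟨fun q => if h : q ∈ S then ⟨q, h⟩ else default, by
    have : (default : Λ) ∈ S := ss.1
    simp [this]
    exact Subtype.ext hdef.symm⟩
  refine ⟨M.map f f g₁ (fun q => q.1), fun l => ?_⟩
  have H := TM0.Machine.map_respects M f f g₁ (fun q => q.1) ss (fun _ => rfl) (by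
    intro q hq
    change ((if h : q ∈ S then (⟨q, h⟩ : S) else default) : S).1 = q
    simp [hq])
  have h2 := StateTransition.tr_eval_dom H (a₁ := TM0.init l) (a₂ := TM0.init l) ⟨ss.1, by
    have := TM0.map_init f g₁ l
    rw [this]
    congr 1
    exact List.map_id l⟩
  rw [h2]
  rfl

open Turing in
theorem trNat_bits (n : ℕ) : PartrecToTM2.trNat n =
    (Nat.bits n).map (fun b => cond b PartrecToTM2.Γ'.bit1 PartrecToTM2.Γ'.bit0) := by
  induction n using Nat.binaryRec' with
  | zero => simp
  | bit b n h ih =>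
    rw [Nat.bits_append_bit _ _ h]
    rw [List.map_cons, ← ih]
    unfold PartrecToTM2.trNat
    rcases b with _ | _
    · have hn : n ≠ 0 := by intro h0; simpa using h h0
      have : ((Nat.bit false n : ℕ) : Num) = Num.bit0 (n : Num) := by
        rw [← Num.ofNat'_eq, Num.ofNat'_bit, Num.ofNat'_eq]; rfl
      rw [this]
      have h3 : (n : Num) ≠ 0 := by exact_mod_cast hn
      revert h3
      cases (n : Num) with
      | zero => intro h; exact absurd rfl h
      | pos p => intro _; rfl
    · have : ((Nat.bit true n : ℕ) : Num) = Num.bit1 (n : Num) := by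
        rw [← Num.ofNat'_eq, Num.ofNat'_bit, Num.ofNat'_eq]; rfl
      rw [this]
      cases (n : Num) <;> rfl

open Turing in
instance finiteKp : Finite PartrecToTM2.K' := by
  classical
  exact Finite.of_injective (β := Fin 4) (fun k => match k with
    | .main => 0 | .rev => 1 | .aux => 2 | .stack => 3) (by
    intro a b; cases a <;> cases b <;> simp)

open Turing in
theorem exists_tm (c : ToPartrec.Code) : ∃ (Γ Λ : Type) (_ : Finite Γ) (_ : Inhabited Γ)
    (_ : Finite Λ) (_ : Inhabited Λ) (M : TM0.Machine Γ Λ) (b0 b1 hd : Γ), ∀ n : ℕ,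
    (StateTransition.eval (TM0.step M)
      (TM0.init (hd :: ((Nat.bits n).map (fun b => cond b b1 b0)).reverse))).Dom ↔
      (c.eval [n]).Dom := by
  classical
  let iΛ : Inhabited PartrecToTM2.Λ' := ⟨PartrecToTM2.trNormal c PartrecToTM2.Cont'.halt⟩
  have s2 := PartrecToTM2.tr_supports c PartrecToTM2.Cont'.halt
  have s1 := TM2to1.tr_supports _ s2
  have s0 := TM1to0.tr_supports _ s1
  obtain ⟨iS, M', hM'⟩ := tm0_restrict _ _ s0
  let enc : PartrecToTM2.Γ' → TM2to1.Γ' PartrecToTM2.K' (fun _ => PartrecToTM2.Γ') :=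
    fun a => (false, Function.update (fun _ => none) PartrecToTM2.K'.main (some a))
  let hd : TM2to1.Γ' PartrecToTM2.K' (fun _ => PartrecToTM2.Γ') :=
    (true, Function.update (fun _ => none) PartrecToTM2.K'.main (some .cons))
  refine ⟨TM2to1.Γ' PartrecToTM2.K' (fun _ => PartrecToTM2.Γ'), _, ?_, inferInstance, ?_,
    inferInstance, M', enc .bit0, enc .bit1, hd, fun n => ?_⟩
  · unfold TM2to1.Γ'; infer_instance
  · exact Finset.finite_toSet _
  · have e1 : TM2to1.trInit (Γ := fun _ => PartrecToTM2.Γ') PartrecToTM2.K'.main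
        (PartrecToTM2.trList [n]) =
        (hd :: ((Nat.bits n).map (fun b => cond b (enc .bit1) (enc .bit0))).reverse) := by
      simp only [PartrecToTM2.trList, trNat_bits, TM2to1.trInit, List.reverse_append,
        List.reverse_cons, List.reverse_nil, List.nil_append, List.singleton_append]
      change hd :: List.map enc _ = _
      rw [List.map_reverse, List.map_map]
      congr 3
      funext b
      cases b <;> rfl
    have h := hM' (TM2to1.trInit (Γ := fun _ => PartrecToTM2.Γ') PartrecToTM2.K'.main
        (PartrecToTM2.trList [n]))
    have e2 := PartrecToTM2.tr_eval c [n]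
    have e3 : (TM2.init (Γ := fun _ => PartrecToTM2.Γ') PartrecToTM2.K'.main
        (PartrecToTM2.trList [n]) : PartrecToTM2.Cfg') = PartrecToTM2.init c [n] := by
      unfold TM2.init PartrecToTM2.init
      congr 1
      funext k
      cases k <;> rfl
    have h2 : (TM0.eval (TM1to0.tr (TM2to1.tr PartrecToTM2.tr))
        (TM2to1.trInit (Γ := fun _ => PartrecToTM2.Γ') PartrecToTM2.K'.main
        (PartrecToTM2.trList [n]))).Dom ↔ (c.eval [n]).Dom := by
      rw [TM1to0.tr_eval]
      refine (TM2to1.tr_eval_dom _ _ _).trans ?_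
      change (StateTransition.eval _ (TM2.init (Γ := fun _ => PartrecToTM2.Γ')
        PartrecToTM2.K'.main (PartrecToTM2.trList [n]))).Dom ↔ _
      rw [e3, e2]
      rfl
    rw [e1] at h h2
    exact h.trans h2
end

section
open Turing
set_option linter.unusedSectionVars false
set_option linter.unusedVariables false
set_option linter.unusedSimpArgs false

section CA
variable {Γ Λ : Type} [Inhabited Γ] [Inhabited Λ] (M : TM0.Machine Γ Λ)

def incoming (c : Option (Γ × Option Λ)) (d : Dir) : Option Λ :=
  match c with
  | some (g, some q) =>
    match M q g with
    | some (q', TM0.Stmt.move d') => if d' = d then some q' else none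
    | _ => none
  | _ => none

def caF (l m r : Option (Γ × Option Λ)) : Option (Γ × Option Λ) :=
  match m with
  | none => none
  | some (g, some q) =>
    match M q g with
    | none => some (g, some q)
    | some (q', TM0.Stmt.write b) => some (b, some q')
    | some (_, TM0.Stmt.move _) => some (g, none)
  | some (g, none) =>
    match incoming M l Dir.left with
    | some q' => some (g, some q')
    | none => some (g, incoming M r Dir.right)

inductive Der (W : ℕ) (ini : ℕ → Option (Γ × Option Λ)) : ℕ → Option (Γ × Option Λ) → Prop
  | ini (i : ℕ) (h : i < W) : Der W ini i (ini i)
  | wall (i : ℕ) (h : Der W ini i none) : Der W ini (i + W) none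
  | step (i : ℕ) (l m r : Option (Γ × Option Λ)) (hl : Der W ini i l) (hm : Der W ini (i+1) m)
      (hr : Der W ini (i+2) r) : Der W ini (i + 1 + W) (caF M l m r)

def row (W : ℕ) (ini : ℕ → Option (Γ × Option Λ)) : ℕ → ℕ → Option (Γ × Option Λ)
  | 0, j => ini j
  | t+1, j => if j = 0 then none else
      caF M (row W ini t (j-1)) (row W ini t j) (if j + 1 < W then row W ini t (j+1) else none)

variable {M}

theorem row_zero {W : ℕ} {ini : ℕ → Option (Γ × Option Λ)} (h0 : ini 0 = none) (t : ℕ) :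
    row M W ini t 0 = none := by
  cases t <;> simp [row, h0]

theorem der_row {W : ℕ} {ini : ℕ → Option (Γ × Option Λ)} (h0 : ini 0 = none) (hW : 2 ≤ W)
    (i : ℕ) (a : Option (Γ × Option Λ)) (h : Der M W ini i a) :
    ∀ t j, i = t * W + j → j < W → a = row M W ini t j := by
  induction h with
  | ini i h =>
    intro t j e hj
    have : t = 0 := by
      by_contra hne
      have : 1 * W ≤ t * W := Nat.mul_le_mul_right _ (by omega)
      omega
    subst this
    simp [row, e]
  | wall i h ih =>
    intro t j e hj
    cases t with
    | zero => omega
    | succ t =>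
      have := ih t j (by rw [Nat.add_mul] at e; omega) hj
      simp [row, ← this, caF]
  | step i l m r hl hm hr ihl ihm ihr =>
    intro t j e hj
    cases t with
    | zero => omega
    | succ t =>
      have e' : i + 1 = t * W + j := by rw [Nat.add_mul] at e; omega
      have h1 := ihm t j e' hj
      rcases Nat.eq_zero_or_pos j with rfl | hj0
      · rw [row_zero h0] at h1 ⊢
        simp [h1, caF]
      · have h2 := ihl t (j-1) (by omega) (by omega)
        have h3 : r = if j + 1 < W then row M W ini t (j+1) else none := by
          split_ifs with hh
          · exact ihr t (j+1) (by omega) hh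
          · rw [ihr (t+1) 0 (by rw [Nat.add_mul]; omega) (by omega), row_zero h0]
        rw [row, if_neg (by omega), ← h1, ← h2, ← h3]

theorem row_der {W : ℕ} {ini : ℕ → Option (Γ × Option Λ)} (h0 : ini 0 = none) (hW : 2 ≤ W)
    (t : ℕ) : ∀ j, j < W → Der M W ini (t * W + j) (row M W ini t j) := by
  have wall : ∀ t, Der M W ini (t * W) none := by
    intro t
    induction t with
    | zero =>
      have := Der.ini (M := M) (W := W) (ini := ini) 0 (by omega)
      rw [h0] at this
      simpa using this
    | succ t ih => rw [Nat.add_mul, one_mul]; exact Der.wall _ ih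
  induction t with
  | zero => intro j hj; simpa [row] using Der.ini (M := M) (ini := ini) j hj
  | succ t ih =>
    intro j hj
    rcases Nat.eq_zero_or_pos j with rfl | hj0
    · rw [row_zero h0]; exact wall _
    · have h1 := ih (j-1) (by omega)
      have h2 := ih j hj
      have h3 : Der M W ini (t * W + (j+1)) (if j + 1 < W then row M W ini t (j+1) else none) := by
        split_ifs with hh
        · exact ih _ hh
        · have := wall (t+1)
          rw [Nat.add_mul] at this
          convert this using 1
          omega
      have e1 : t * W + j = (t * W + (j - 1)) + 1 := by omega
      have e2 : t * W + (j+1) = (t * W + (j - 1)) + 2 := by omega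
      rw [e1] at h2
      rw [e2] at h3
      have := Der.step _ _ _ _ h1 h2 h3
      rw [row, if_neg (by omega)]
      convert this using 1
      rw [Nat.add_mul]; omega

def CAInv (R : ℕ → Option (Γ × Option Λ)) (W : ℕ) (c : TM0.Cfg Γ Λ) (p : ℕ) : Prop :=
  1 ≤ p ∧ p < W ∧ ∀ j, 1 ≤ j → j < W →
    R j = some (c.Tape.nth ((p : ℤ) - j), if j = p then some c.q else none)

def NoHead (R : ℕ → Option (Γ × Option Λ)) (W : ℕ) : Prop :=
  ∀ j, j < W → ∀ g q, R j ≠ some (g, some q)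

theorem incoming_none {c : Option (Γ × Option Λ)} (h : ∀ g q, c ≠ some (g, some q)) (d : Dir) :
    incoming M c d = none := by
  unfold incoming
  split
  · rename_i g q
    exact absurd rfl (h g q)
  · rfl

theorem noHead_step {W : ℕ} {ini : ℕ → Option (Γ × Option Λ)} {t : ℕ} (h0 : ini 0 = none)
    (h : NoHead (row M W ini t) W) : NoHead (row M W ini (t+1)) W := by
  intro j hj g q
  rw [row]
  split_ifs with h1 h2
  · simp
  all_goals
    have hl : incoming M (row M W ini t (j-1)) Dir.left = none :=
      incoming_none (h _ (by omega)) _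
    have hm := h j hj
  · have hr : incoming M (row M W ini t (j+1)) Dir.right = none :=
      incoming_none (h _ (by omega)) _
    unfold caF
    split
    · simp
    · rename_i g q heq; exact absurd heq (hm g q)
    · simp [hl, hr]
  · unfold caF
    split
    · simp
    · rename_i g q heq; exact absurd heq (hm g q)
    · rw [hl, incoming_none (c := none) (by simp)]; simp

def nextRow (M : TM0.Machine Γ Λ) (W : ℕ) (R : ℕ → Option (Γ × Option Λ)) (j : ℕ) :
    Option (Γ × Option Λ) :=
  if j = 0 then none else caF M (R (j-1)) (R j) (if j + 1 < W then R (j+1) else none)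

theorem row_succ {W : ℕ} {ini : ℕ → Option (Γ × Option Λ)} (t : ℕ) :
    row M W ini (t+1) = nextRow M W (row M W ini t) := by
  funext j; rw [row, nextRow]

theorem inc_eq {W : ℕ} {R : ℕ → Option (Γ × Option Λ)} (h0 : R 0 = none) {q : Λ} {T : Tape Γ}
    {p : ℕ} (h : CAInv R W ⟨q, T⟩ p) (j : ℕ) (hj : j < W) (d : Dir) :
    incoming M (R j) d = if j = p then incoming M (some (T.nth 0, some q)) d else none := by
  obtain ⟨h1, h2, h3⟩ := h
  rcases Nat.eq_zero_or_pos j with rfl | hj0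
  · rw [if_neg (by omega), h0]; rfl
  · rw [h3 j hj0 hj]
    by_cases hp : j = p
    · simp [hp]
    · rw [if_neg hp, if_neg hp]; rfl

theorem inc_eq' {W : ℕ} {R : ℕ → Option (Γ × Option Λ)} (h0 : R 0 = none) {q : Λ} {T : Tape Γ}
    {p : ℕ} (h : CAInv R W ⟨q, T⟩ p) (j : ℕ) (d : Dir) :
    incoming M (if j < W then R j else none) d =
      if j = p then incoming M (some (T.nth 0, some q)) d else none := by
  split_ifs with h1 h2
  · rw [inc_eq h0 h j h1, if_pos h2]
  · rw [inc_eq h0 h j h1, if_neg h2]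
  · have := h.2.1; omega
  · rfl

theorem nextRow_inv {W : ℕ} {R : ℕ → Option (Γ × Option Λ)} (h0 : R 0 = none) {q : Λ} {T : Tape Γ}
    {p : ℕ} (h : CAInv R W ⟨q, T⟩ p) (j : ℕ) (hj1 : 1 ≤ j) (hj : j < W) :
    nextRow M W R j = if j = p then
        (match M q T.head with
          | none => some (T.nth 0, some q)
          | some (q', TM0.Stmt.write b) => some (b, some q')
          | some (_, TM0.Stmt.move _) => some (T.nth 0, none))
      else some (T.nth ((p : ℤ) - j),
        if j = p + 1 then incoming M (some (T.nth 0, some q)) Dir.left else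
        if j + 1 = p then incoming M (some (T.nth 0, some q)) Dir.right else none) := by
  have e := h.2.2 j hj1 hj
  have e1 := inc_eq (M := M) h0 h (j-1) (by omega) Dir.left
  have e2 := inc_eq' (M := M) h0 h (j+1) Dir.right
  rw [nextRow, if_neg (by omega), e]
  by_cases hp : j = p
  · subst hp
    simp only [sub_self, if_true, caF, Tape.nth_zero]
  · simp only [hp, if_false, caF, e1, e2]
    have hx : (j - 1 = p) = (j = p + 1) := by apply propext; omega
    simp only [hx]
    by_cases h1 : j = p + 1
    · simp only [h1, if_true]
      have : ¬ (p + 1 + 1 = p) := by omega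
      simp only [this, if_false]
      split <;> simp_all
    · simp [h1]

theorem step_none {W : ℕ} {R : ℕ → Option (Γ × Option Λ)} (h0 : R 0 = none) {q : Λ} {T : Tape Γ}
    {p : ℕ} (h : CAInv R W ⟨q, T⟩ p) (hM : M q T.head = none) :
    CAInv (nextRow M W R) W ⟨q, T⟩ p := by
  refine ⟨h.1, h.2.1, fun j h1 h2 => ?_⟩
  rw [nextRow_inv h0 h j h1 h2]
  split_ifs with hp <;> simp [hM, hp, incoming]

theorem step_write {W : ℕ} {R : ℕ → Option (Γ × Option Λ)} (h0 : R 0 = none) {q q' : Λ} {b : Γ}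
    {T : Tape Γ}
    {p : ℕ} (h : CAInv R W ⟨q, T⟩ p) (hM : M q T.head = some (q', TM0.Stmt.write b)) :
    CAInv (nextRow M W R) W ⟨q', T.write b⟩ p := by
  refine ⟨h.1, h.2.1, fun j h1 h2 => ?_⟩
  rw [nextRow_inv h0 h j h1 h2]
  have : (p : ℤ) - j = 0 ↔ j = p := by omega
  split_ifs with hp <;> simp [hM, hp, incoming, Tape.write_nth, this]
  rfl

theorem step_left {W : ℕ} {R : ℕ → Option (Γ × Option Λ)} (h0 : R 0 = none) {q q' : Λ}
    {T : Tape Γ}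
    {p : ℕ} (h : CAInv R W ⟨q, T⟩ p) (hM : M q T.head = some (q', TM0.Stmt.move Dir.left)) 
    (hp : p + 1 < W) :
    CAInv (nextRow M W R) W ⟨q', T.move Dir.left⟩ (p+1) := by
  refine ⟨by omega, hp, fun j h1 h2 => ?_⟩
  rw [nextRow_inv h0 h j h1 h2]
  have : ((p+1 : ℕ) : ℤ) - j - 1 = p - j := by push_cast; ring
  rw [Tape.move_left_nth, this]
  split_ifs with hp <;> simp [hM, hp, incoming] <;> omega

theorem step_right {W : ℕ} {R : ℕ → Option (Γ × Option Λ)} (h0 : R 0 = none) {q q' : Λ}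
    {T : Tape Γ}
    {p : ℕ} (h : CAInv R W ⟨q, T⟩ (p+1)) (hM : M q T.head = some (q', TM0.Stmt.move Dir.right)) 
    (hp : 1 ≤ p) :
    CAInv (nextRow M W R) W ⟨q', T.move Dir.right⟩ p := by
  refine ⟨by omega, by have := h.2.1; omega, fun j h1 h2 => ?_⟩
  rw [nextRow_inv h0 h j h1 h2]
  have : ((p : ℕ) : ℤ) - j + 1 = ((p+1 : ℕ) : ℤ) - j := by push_cast; ring
  rw [Tape.move_right_nth, this]
  split_ifs with hp <;> simp [hM, hp, incoming] <;> omega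

theorem step_left' {W : ℕ} {R : ℕ → Option (Γ × Option Λ)} (h0 : R 0 = none) {q q' : Λ}
    {T : Tape Γ}
    {p : ℕ} (h : CAInv R W ⟨q, T⟩ p) (hM : M q T.head = some (q', TM0.Stmt.move Dir.left)) 
    (hp : ¬ p + 1 < W) : NoHead (nextRow M W R) W := by
  intro j hj g q
  rcases Nat.eq_zero_or_pos j with rfl | hj0
  · simp [nextRow]
  rw [nextRow_inv h0 h j hj0 hj]
  split_ifs with hp <;> simp [hM, hp, incoming] <;> omega

theorem step_right' {W : ℕ} {R : ℕ → Option (Γ × Option Λ)} (h0 : R 0 = none) {q q' : Λ}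
    {T : Tape Γ}
    {p : ℕ} (h : CAInv R W ⟨q, T⟩ p) (hM : M q T.head = some (q', TM0.Stmt.move Dir.right)) 
    (hp : p ≤ 1) : NoHead (nextRow M W R) W := by
  intro j hj g q
  rcases Nat.eq_zero_or_pos j with rfl | hj0
  · simp [nextRow]
  rw [nextRow_inv h0 h j hj0 hj]
  split_ifs with hp <;> simp [hM, hp, incoming] <;> omega

theorem sound_row {W : ℕ} {ini : ℕ → Option (Γ × Option Λ)} (h0 : ini 0 = none)
    {c0 : TM0.Cfg Γ Λ} {p0 : ℕ} (hi : CAInv ini W c0 p0) (t : ℕ) :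
    (∃ c p, StateTransition.Reaches (TM0.step M) c0 c ∧ CAInv (row M W ini t) W c p) ∨
      NoHead (row M W ini t) W := by
  induction t with
  | zero => exact Or.inl ⟨c0, p0, Relation.ReflTransGen.refl, hi⟩
  | succ t ih =>
    rcases ih with ⟨⟨q, T⟩, p, hr, hinv⟩ | hn
    · have h0' := row_zero (M := M) (W := W) h0 t
      rw [row_succ]
      rcases hM : M q T.head with _ | ⟨q', (_ | _) | b⟩
      · exact Or.inl ⟨_, p, hr, step_none h0' hinv hM⟩
      · by_cases hp : p + 1 < W
        · refine Or.inl ⟨_, _, hr.tail ?_, step_left h0' hinv hM hp⟩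
          simp [TM0.step, hM]
        · exact Or.inr (step_left' h0' hinv hM hp)
      · by_cases hp : p ≤ 1
        · exact Or.inr (step_right' h0' hinv hM hp)
        · obtain ⟨p, rfl⟩ : ∃ p', p = p' + 1 := ⟨p - 1, by omega⟩
          refine Or.inl ⟨_, _, hr.tail ?_, step_right h0' hinv hM (by omega)⟩
          simp [TM0.step, hM]
      · refine Or.inl ⟨_, _, hr.tail ?_, step_write h0' hinv hM⟩
        simp [TM0.step, hM]
    · exact Or.inr (noHead_step h0 hn)

theorem complete_row {c0 c : TM0.Cfg Γ Λ} (hr : StateTransition.Reaches (TM0.step M) c0 c) :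
    ∃ K, ∀ e p W (ini : ℕ → Option (Γ × Option Λ)), ini 0 = none → CAInv ini W c0 p →
      K + e < p → p + K + e < W →
      ∃ t p', e < p' ∧ p' + e < W ∧ CAInv (row M W ini t) W c p' := by
  induction hr with
  | refl => exact ⟨0, fun e p W ini h0 hi h1 h2 => ⟨0, p, by omega, by omega, hi⟩⟩
  | tail hr hs ih =>
    obtain ⟨K, hK⟩ := ih
    refine ⟨K + 1, fun e p W ini h0 hi h1 h2 => ?_⟩
    obtain ⟨t, p', hp1, hp2, hinv⟩ := hK (e+1) p W ini h0 hi (by omega) (by omega)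
    have h0' := row_zero (M := M) (W := W) h0 t
    rename_i b c'
    obtain ⟨q, T⟩ := b
    refine ⟨t + 1, ?_⟩
    rw [row_succ]
    rcases hM : M q T.head with _ | ⟨q', (_ | _) | b⟩ <;> simp [TM0.step, hM] at hs
    · subst hs
      exact ⟨_, by omega, by omega, step_left h0' hinv hM (by omega)⟩
    · subst hs
      obtain ⟨p, rfl⟩ : ∃ p1, p' = p1 + 1 := ⟨p' - 1, by omega⟩
      exact ⟨_, by omega, by omega, step_right h0' hinv hM (by omega)⟩
    · subst hs
      exact ⟨_, by omega, by omega, step_write h0' hinv hM⟩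

/-- initial row -/
def iniRow (T : Tape Γ) (p : ℕ) (j : ℕ) : Option (Γ × Option Λ) :=
  if j = 0 then none else some (T.nth ((p : ℤ) - j), if j = p then some default else none)

theorem halts_iff (l : List Γ) (s : ℕ) :
    (StateTransition.eval (TM0.step M) (TM0.init l)).Dom ↔
      ∃ p0 W i g q, 1 ≤ p0 ∧ p0 + s < W ∧
        Der M W (iniRow (Tape.mk₁ l) (p0 + s)) i (some (g, some q)) ∧ M q g = none := by
  constructor
  · intro h
    obtain ⟨c, hc⟩ := Part.dom_iff_mem.1 h
    obtain ⟨hr, hs⟩ := StateTransition.mem_eval.1 hc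
    obtain ⟨K, hK⟩ := complete_row hr
    have hinv : CAInv (iniRow (Λ := Λ) (Tape.mk₁ l) (K + 1 + s)) (K + 1 + s + K + 1) (TM0.init l)
        (K + 1 + s) := by
      refine ⟨by omega, by omega, fun j h1 h2 => ?_⟩
      rw [iniRow, if_neg (by omega)]; rfl
    obtain ⟨t, p', h1, h2, h3⟩ := hK 0 _ _ _ (by simp [iniRow]) hinv (by omega) (by omega)
    obtain ⟨q, T⟩ := c
    refine ⟨K + 1, K + 1 + s + K + 1, t * (K + 1 + s + K + 1) + p', T.nth 0, q, by omega, by omega, ?_, ?_⟩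
    · have := row_der (M := M) (W := K + 1 + s + K + 1) (ini := iniRow (Tape.mk₁ l) (K + 1 + s))
        (by simp [iniRow]) (by omega) t p' h3.2.1
      rw [h3.2.2 p' h3.1 h3.2.1] at this
      simpa using this
    · simpa [TM0.step] using hs
  · rintro ⟨p0, W, i, g, q, h1, h2, hd, hM⟩
    have hinv : CAInv (iniRow (Λ := Λ) (Tape.mk₁ l) (p0 + s)) W (TM0.init l)
        (p0 + s) := by
      refine ⟨by omega, by omega, fun j h1 h2 => ?_⟩
      rw [iniRow, if_neg (by omega)]; rfl
    have hlt : i % W < W := Nat.mod_lt _ (by omega)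
    have := der_row (by simp [iniRow]) (by omega) i _ hd (i / W) (i % W)
      (by rw [mul_comm]; exact (Nat.div_add_mod i W).symm) hlt
    rcases sound_row (M := M) (by simp [iniRow]) hinv (i / W) with ⟨⟨q', T⟩, p, hr, hi⟩ | hn
    · rw [Part.dom_iff_mem]
      refine ⟨⟨q', T⟩, StateTransition.mem_eval.2 ⟨hr, ?_⟩⟩
      rcases Nat.eq_zero_or_pos (i % W) with hz | hz
      · rw [hz, row_zero (by simp [iniRow])] at this
        simp at this
      · rw [hi.2.2 _ hz hlt] at this
        by_cases hp : i % W = p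
        · simp [hp] at this
          simp only [TM0.step, ← this.1, ← this.2, hM]
          rfl
        · simp [hp] at this
    · exact absurd this.symm (hn _ hlt g q)

def iniF (b0 b1 hd : Γ) (n p0 s j : ℕ) : Option (Γ × Option Λ) :=
  if j = 0 then none else if j = p0 + s then some (hd, some default) else
  if p0 ≤ j ∧ j < p0 + s then some (cond (n.testBit (j - p0)) b1 b0, none) else some (default, none)

theorem mk1_nth_neg (l : List Γ) (i : ℕ) : (Tape.mk₁ l).nth (-(i+1 : ℤ)) = default := by
  have : (-(i+1 : ℤ)) = Int.negSucc i := by simp [Int.negSucc_eq]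
  rw [this]
  change (Tape.mk₁ l).left.nth i = _
  simp [Tape.mk₁, Tape.mk₂, Tape.mk', ListBlank.nth_mk]

theorem mk1_nth_nat (l : List Γ) (i : ℕ) : (Tape.mk₁ l).nth (i : ℤ) = l.getI i := by
  rw [Tape.mk₁, Tape.mk₂, Tape.mk'_nth_nat, ListBlank.nth_mk]

theorem iniRow_eq (b0 b1 hd : Γ) (n p0 j : ℕ) :
    iniRow (Λ := Λ) (Tape.mk₁ (hd :: ((Nat.bits n).map (fun b => cond b b1 b0)).reverse))
      (p0 + n.size) j = iniF b0 b1 hd n p0 n.size j := by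
  unfold iniRow iniF
  split_ifs with h1 h2 h3
  · rfl
  · subst h2
    rw [sub_self]
    have := mk1_nth_nat (hd :: ((Nat.bits n).map (fun b => cond b b1 b0)).reverse) 0
    simp only [Nat.cast_zero] at this
    rw [this]; simp
  · obtain ⟨k, hk⟩ : ∃ k, p0 + n.size = j + k + 1 := ⟨p0 + n.size - j - 1, by omega⟩
    have e : ((p0 + n.size : ℕ) : ℤ) - j = ((k + 1 : ℕ) : ℤ) := by rw [hk]; push_cast; ring
    rw [e, mk1_nth_nat]
    have hl : n.bits.length = n.size := Nat.size_eq_bits_len n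
    have hk' : k < (((Nat.bits n).map (fun b => cond b b1 b0)).reverse).length := by
      simp [hl]; omega
    rw [List.getI_cons_succ, List.getI_eq_getElem _ hk', List.getElem_reverse, List.getElem_map]
    congr 3
    rw [Nat.testBit_eq_inth, List.getI_eq_getElem _ (by omega)]
    congr 1
    simp [hl]; omega
  · by_cases hj : j < p0 + n.size
    · obtain ⟨k, hk⟩ : ∃ k, p0 + n.size = j + k + 1 := ⟨p0 + n.size - j - 1, by omega⟩
      have e : ((p0 + n.size : ℕ) : ℤ) - j = ((k + 1 : ℕ) : ℤ) := by rw [hk]; push_cast; ring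
      rw [e, mk1_nth_nat]
      have hl : n.bits.length = n.size := Nat.size_eq_bits_len n
      rw [List.getI_cons_succ, List.getI_eq_default]
      simp [hl]; omega
    · obtain ⟨k, hk⟩ : ∃ k, j = p0 + n.size + k + 1 := ⟨j - (p0 + n.size) - 1, by omega⟩
      have e : ((p0 + n.size : ℕ) : ℤ) - j = -(k + 1 : ℤ) := by rw [hk]; push_cast; ring
      rw [e, mk1_nth_neg]

theorem halts_iff' (b0 b1 hd : Γ) (n : ℕ) :
    (StateTransition.eval (TM0.step M)
      (TM0.init (hd :: ((Nat.bits n).map (fun b => cond b b1 b0)).reverse))).Dom ↔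
      ∃ p0 W i g q, 1 ≤ p0 ∧ p0 + n.size < W ∧
        Der M W (iniF b0 b1 hd n p0 n.size) i (some (g, some q)) ∧ M q g = none := by
  rw [halts_iff _ n.size]
  have : ∀ p0, iniRow (Λ := Λ) (Tape.mk₁ (hd :: ((Nat.bits n).map (fun b => cond b b1 b0)).reverse))
      (p0 + n.size) = iniF b0 b1 hd n p0 n.size := fun p0 => funext (iniRow_eq b0 b1 hd n p0)
  simp only [this]

end CA
end

section
section Arith

theorem and_add_or_aux (x y : ℕ) : (x &&& y) + (x ||| y) = x + y := by
  induction x using Nat.strong_induction_on generalizing y with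
  | _ x ih =>
    rcases Nat.eq_zero_or_pos x with rfl | hx
    · simp
    · have h := ih (x / 2) (by omega) (y / 2)
      have h1 : (x &&& y) / 2 = x / 2 &&& y / 2 := Nat.and_div_two
      have h2 : (x ||| y) / 2 = x / 2 ||| y / 2 := Nat.or_div_two
      have h3 := Nat.testBit_and x y 0
      have h4 := Nat.testBit_or x y 0
      simp only [Nat.testBit_zero] at h3 h4
      rw [← h1, ← h2] at h
      clear h1 h2
      generalize x &&& y = s at *
      generalize x ||| y = r at *
      rcases Nat.mod_two_eq_zero_or_one x with h5 | h5 <;>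
      rcases Nat.mod_two_eq_zero_or_one y with h6 | h6 <;>
      simp [h5, h6] at h3 h4 <;> omega

/-- bitwise inclusion -/
def Msk (x y : ℕ) : Prop := ∀ i, x.testBit i = true → y.testBit i = true

theorem msk_le {x y : ℕ} (h : Msk x y) : x ≤ y := by
  have : x &&& y = x := by
    apply Nat.eq_of_testBit_eq
    intro i
    have := h i
    rw [Nat.testBit_and]
    cases hx : x.testBit i <;> simp_all
  rw [← this]; exact Nat.and_le_right

theorem msk_sub {x w : ℕ} (h : Msk x w) (i : ℕ) :
    (w - x).testBit i = (w.testBit i && !x.testBit i) := by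
  have e1 : x &&& (w ^^^ x) = 0 := by
    apply Nat.eq_of_testBit_eq
    intro i
    have := h i
    simp only [Nat.testBit_and, Nat.testBit_xor, Nat.zero_testBit]
    cases hx : x.testBit i <;> simp_all
  have e2 : x ||| (w ^^^ x) = w := by
    apply Nat.eq_of_testBit_eq
    intro i
    have := h i
    simp only [Nat.testBit_or, Nat.testBit_xor]
    cases hx : x.testBit i <;> simp_all
  have e := and_add_or_aux x (w ^^^ x)
  rw [e1, e2] at e
  have e3 : w - x = w ^^^ x := by
    generalize w ^^^ x = d at *
    omega
  have := h i
  rw [e3, Nat.testBit_xor]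
  clear e e1 e2 e3
  cases hx : x.testBit i <;> simp_all

theorem and_eq_iff (x y z : ℕ) : x &&& y = z ↔
    Msk z x ∧ Msk z y ∧ Msk x (x + y - z) ∧ Msk y (x + y - z) := by
  have e := and_add_or_aux x y
  constructor
  · rintro rfl
    have : x + y - (x &&& y) = x ||| y := by omega
    rw [this]
    refine ⟨?_, ?_, ?_, ?_⟩ <;> intro i <;> simp +contextual
  · rintro ⟨h1, h2, h3, h4⟩
    have h7 := msk_le h1
    have e1 : x + y - z - x = y - z := by omega
    have s1 := msk_sub h3
    have s2 := msk_sub h2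
    rw [e1] at s1
    apply Nat.eq_of_testBit_eq
    intro i
    have t1 := s1 i
    rw [s2 i] at t1
    have t2 := h1 i
    have t3 := h2 i
    rw [Nat.testBit_and]
    cases hx : x.testBit i <;> cases hy : y.testBit i <;> cases hz : z.testBit i <;> simp_all

theorem lucas2 (x y : ℕ) : y.choose x % 2 = 1 ↔ Msk x y := by
  induction y using Nat.strong_induction_on generalizing x with
  | _ y ih =>
    rcases Nat.eq_zero_or_pos y with rfl | hy
    · cases x with
      | zero => simp [Msk]
      | succ x =>
        simp only [Nat.choose_zero_succ]
        constructor
        · simp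
        · intro h
          have := msk_le h
          omega
    · have h := Choose.choose_modEq_choose_mod_mul_choose_div_nat (p := 2) (n := y) (k := x)
      have hm : Msk x y ↔ (x % 2 = 1 → y % 2 = 1) ∧ Msk (x/2) (y/2) := by
        constructor
        · intro h
          refine ⟨by simpa using h 0, fun i => ?_⟩
          simpa [Nat.testBit_div_two] using h (i+1)
        · rintro ⟨h1, h2⟩ i
          cases i with
          | zero => simpa using h1
          | succ i => simpa [Nat.testBit_div_two] using h2 i
      rw [hm, ← ih (y/2) (by omega), h, Nat.mul_mod]
      rcases Nat.mod_two_eq_zero_or_one x with h5 | h5 <;>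
      rcases Nat.mod_two_eq_zero_or_one y with h6 | h6 <;>
      rcases Nat.mod_two_eq_zero_or_one ((y/2).choose (x/2)) with h7 | h7 <;>
      simp [h5, h6, h7]

theorem sum_digits_lt (u : ℕ) (f : ℕ → ℕ) (hf : ∀ i, f i < u) (k : ℕ) :
    ∑ i ∈ Finset.range k, f i * u ^ i < u ^ k := by
  induction k with
  | zero => simp
  | succ k ih =>
    rw [Finset.sum_range_succ, pow_succ]
    have : (f k + 1) * u ^ k ≤ u * u ^ k := Nat.mul_le_mul_right _ (hf k)
    nlinarith

theorem choose_eq_div (x y : ℕ) : ((2 ^ (y+1) + 1) ^ y / (2 ^ (y+1)) ^ x) % 2 = y.choose x % 2 := by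
  set u := 2 ^ (y+1) with hu
  have hlt : ∀ i, y.choose i < u := by
    intro i
    have h1 := Nat.choose_le_two_pow y i
    have : 2 ^ y < u := Nat.pow_lt_pow_right (by norm_num) (by omega)
    omega
  have hu0 : 0 < u := by positivity
  have e : (u + 1) ^ y = ∑ i ∈ Finset.range (x + (y + 1)), y.choose i * u ^ i := by
    rw [add_pow]
    symm
    rw [← Finset.sum_subset (Finset.range_subset_range.2 (show y + 1 ≤ x + (y+1) by omega))]
    · apply Finset.sum_congr rfl
      intro i _; simp [mul_comm]
    · intro i _ hi
      rw [Nat.choose_eq_zero_of_lt (by simpa using hi)]; simp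
  rw [e, Finset.sum_range_add, Finset.sum_range_succ']
  have e2 : ∑ k ∈ Finset.range y, y.choose (x + (k + 1)) * u ^ (x + (k + 1)) 
     + y.choose (x + 0) * u ^ (x + 0) =
      u ^ x * (y.choose x + 2 * (2 ^ y * ∑ k ∈ Finset.range y, y.choose (x + (k + 1)) * u ^ k)) := by
    rw [mul_add, Finset.mul_sum, Finset.mul_sum, Finset.mul_sum, add_comm, add_zero, mul_comm]
    congr 1
    apply Finset.sum_congr rfl
    intro k _
    rw [pow_add, pow_succ u k]
    conv_lhs => rw [hu]
    rw [pow_succ 2 y]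
    ring
  rw [e2, Nat.add_mul_div_left _ _ (by positivity), Nat.div_eq_of_lt (sum_digits_lt u _ hlt x)]
  omega

end Arith

section DiophBits
open Dioph
variable {α : Type} 

theorem msk_dioph {f g : (α → ℕ) → ℕ} (df : DiophFn f) (dg : DiophFn g) :
    Dioph {v | Msk (f v) (g v)} := by
  have h2 : DiophFn fun v => 2 ^ (g v + 1) :=
    pow_dioph (const_dioph 2) (add_dioph dg (const_dioph 1))
  refine Dioph.ext (eq_dioph (mod_dioph (div_dioph (pow_dioph (add_dioph h2 (const_dioph 1)) dg)
    (pow_dioph h2 df)) (const_dioph 2)) (const_dioph 1)) fun v => ?_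
  change _ = _ ↔ _
  simp only [Function.const]
  exact (choose_eq_div (f v) (g v)) ▸ lucas2 (f v) (g v)

theorem land_dioph {f g : (α → ℕ) → ℕ} (df : DiophFn f) (dg : DiophFn g) :
    DiophFn fun v => f v &&& g v := by
  have a := reindex_diophFn (some : α → Option α) df
  have b := reindex_diophFn (some : α → Option α) dg
  have c := proj_dioph (none : Option α)
  have d := sub_dioph (add_dioph a b) c
  refine Dioph.ext ((msk_dioph c a).inter ((msk_dioph c b).inter ((msk_dioph a d).inter
    (msk_dioph b d)))) fun v => ?_
  exact (and_eq_iff _ _ _).symm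

theorem lor_dioph {f g : (α → ℕ) → ℕ} (df : DiophFn f) (dg : DiophFn g) :
    DiophFn fun v => f v ||| g v := by
  have := sub_dioph (add_dioph df dg) (land_dioph df dg)
  convert this using 2 with v
  have := and_add_or_aux (f v) (g v)
  omega

def orL {ι : Type} (l : List ι) (f : ι → ℕ) : ℕ := l.foldr (fun t acc => f t ||| acc) 0

theorem orL_testBit {ι : Type} (l : List ι) (f : ι → ℕ) (i : ℕ) :
    (orL l f).testBit i = true ↔ ∃ t ∈ l, (f t).testBit i = true := by
  induction l with
  | nil => simp [orL]
  | cons a l ih =>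
    have : orL (a :: l) f = f a ||| orL l f := rfl
    rw [this, Nat.testBit_or, Bool.or_eq_true, ih]
    simp

theorem orL_eq_zero {ι : Type} (l : List ι) (f : ι → ℕ) :
    orL l f = 0 ↔ ∀ t ∈ l, f t = 0 := by
  induction l with
  | nil => simp [orL]
  | cons a l ih =>
    have : orL (a :: l) f = f a ||| orL l f := rfl
    rw [this, Nat.or_eq_zero_iff, ih]
    simp

theorem orL_dioph {ι : Type} (l : List ι) (f : ι → (α → ℕ) → ℕ) (h : ∀ t, DiophFn (f t)) :
    DiophFn fun v => orL l (fun t => f t v) := by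
  induction l with
  | nil => exact const_dioph 0
  | cons a l ih => exact lor_dioph (h a) ih

theorem ite_dioph {c : Prop} [Decidable c] {f : (α → ℕ) → ℕ} (df : DiophFn f) :
    DiophFn fun v => if c then f v else 0 := by
  by_cases h : c
  · simpa [h] using df
  · simp only [h, if_false]; exact const_dioph 0

end DiophBits
end

section
section
set_option linter.unusedSimpArgs false
open Turing Dioph Classical

theorem ite_testBit_aux (c : Prop) [Decidable c] (x j : ℕ) :
    (if c then x else 0).testBit j = true ↔ c ∧ x.testBit j = true := by
  by_cases h : c <;> simp [h]

theorem exists_mask (N : ℕ) (P : ℕ → Prop) : ∃ x : ℕ, ∀ i, x.testBit i = true ↔ i < N ∧ P i := by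
  refine ⟨orL (List.range N) (fun i => if P i then 2 ^ i else 0), fun i => ?_⟩
  rw [orL_testBit]
  simp only [ite_testBit_aux, Nat.testBit_two_pow, List.mem_range]
  constructor
  · rintro ⟨t, h1, h2, h3⟩
    simp at h3; subst h3; exact ⟨h1, h2⟩
  · rintro ⟨h1, h2⟩
    exact ⟨i, h1, h2, by simp⟩

variable {Γ Λ : Type} [Inhabited Γ] [Inhabited Λ] (M : TM0.Machine Γ Λ)

noncomputable def iniMask (b0 b1 hd : Γ) (n p0 W s : ℕ) (a : Option (Γ × Option Λ)) : ℕ :=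
  (if a = none then 1 else 0) |||
  ((if a = some (b1, none) then n * 2 ^ p0 else 0) |||
  ((if a = some (b0, none) then (2 ^ s - (n + 1)) * 2 ^ p0 else 0) |||
  ((if a = some (hd, some default) then 2 ^ (p0 + s) else 0) |||
  ((if a = some (default, none) then 2 ^ p0 - 2 else 0) |||
  ((if a = some (default, none) then 2 ^ W - 2 ^ (p0 + s + 1) else 0))))))

theorem iniMask_testBit (b0 b1 hd : Γ) (n p0 W s : ℕ) (a : Option (Γ × Option Λ))
    (hp : 1 ≤ p0) (hW : p0 + s < W) (hs : n < 2 ^ s) (j : ℕ) :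
    (iniMask b0 b1 hd n p0 W s a).testBit j = true ↔ j < W ∧ iniF b0 b1 hd n p0 s j = a := by
  have h1 : (1 : ℕ).testBit j = true ↔ j = 0 := by
    rw [show (1 : ℕ) = 2 ^ 0 from rfl, Nat.testBit_two_pow]; simp [eq_comm]
  have h5 : (2 ^ p0 - 2).testBit j = true ↔ j < p0 ∧ j ≠ 0 := by
    have : 1 < 2 ^ p0 := Nat.one_lt_two_pow (by omega)
    rw [show 2 ^ p0 - 2 = 2 ^ p0 - (1 + 1) from rfl, Nat.testBit_two_pow_sub_succ this]
    have h1' : (1 : ℕ).testBit j = decide (j = 0) := by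
      rw [Bool.eq_iff_iff, h1]; simp
    rw [h1']; simp
  have h6 : (2 ^ W - 2 ^ (p0 + s + 1)).testBit j = true ↔ j < W ∧ p0 + s + 1 ≤ j := by
    have e : 2 ^ (p0 + s + 1) = (2 ^ (p0 + s + 1) - 1) + 1 := by
      have : 0 < 2 ^ (p0 + s + 1) := by positivity
      omega
    have e2 : 2 ^ (p0 + s + 1) ≤ 2 ^ W := Nat.pow_le_pow_right (by norm_num) (by omega)
    rw [e, Nat.testBit_two_pow_sub_succ (by omega), Nat.testBit_two_pow_sub_one]
    simp
  have h7 : n.testBit (j - p0) = true → j - p0 < s := by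
    intro h
    by_contra hc
    rw [Nat.testBit_lt_two_pow (lt_of_lt_of_le hs (Nat.pow_le_pow_right (by norm_num) (not_lt.1 hc)))] at h
    simp at h
  simp only [iniMask, Nat.testBit_or, Bool.or_eq_true, ite_testBit_aux, h1, h5, h6,
    Nat.testBit_mul_two_pow, Nat.testBit_two_pow, Nat.testBit_two_pow_sub_succ hs]
  clear h1 h5 h6
  conv_rhs => rw [@eq_comm _ _ a]
  unfold iniF
  by_cases c1 : j = 0
  · subst c1
    simp only [if_true]
    have e1 : ¬ p0 ≤ 0 := by omega
    have e2 : ¬ (p0 + s = 0) := by omega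
    have e3 : 0 < W := by omega
    simp [e1, e2, e3]
    omega
  by_cases c2 : j = p0 + s
  · subst c2
    simp only [c1, if_true, if_false]
    have e : p0 + s - p0 = s := by omega
    rw [e] at h7
    have e1 : ¬ (p0 = 0 ∧ s = 0) := by omega
    have e2 : n.testBit s = false := by
      cases h : n.testBit s
      · rfl
      · exact absurd (h7 h) (by omega)
    simp [hW, e, e1, e2]
  by_cases c3 : p0 ≤ j ∧ j < p0 + s
  · have e1 : ¬ (p0 + s = j) := by omega
    have e2 : ¬ (j < p0) := by omega
    have e3 : ¬ (p0 + s + 1 ≤ j) := by omega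
    have e4 : j - p0 < s := by omega
    have e5 : j < W := by omega
    cases hb : n.testBit (j - p0) <;> simp [c1, c2, c3, e1, e2, e3, e4, e5, hb]
  · have e0 : ¬ (p0 + s = j) := by omega
    simp only [c1, c2, c3, if_false]
    by_cases c4 : p0 ≤ j
    · have e1 : ¬ (j - p0 < s) := by omega
      have e2 : n.testBit (j - p0) = false := by
        cases h : n.testBit (j - p0)
        · rfl
        · exact absurd (h7 h) e1
      have e3 : p0 + s + 1 ≤ j := by omega
      have e4 : ¬ (j < p0) := by omega
      simp [e0, e1, e2, e3, e4, c4, and_comm]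
    · have e1 : j < W := by omega
      have e2 : ¬ (p0 + s + 1 ≤ j) := by omega
      have e4 : j < p0 := by omega
      simp [e0, e1, e2, e4, c4, c1]

variable [Fintype Γ] [Fintype Λ]

noncomputable def rhsMask (b0 b1 hd : Γ) (n p0 W s : ℕ) (X : Option (Γ × Option Λ) → ℕ)
    (a : Option (Γ × Option Λ)) : ℕ :=
  iniMask b0 b1 hd n p0 W s a ||| ((if a = none then 2 ^ W * X none else 0) |||
    orL (Finset.univ : Finset (Option (Γ × Option Λ) × Option (Γ × Option Λ) × Option (Γ × Option Λ))).toList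
      (fun t => if caF M t.1 t.2.1 t.2.2 = a then
        2 ^ W * ((2 ^ 1 * X t.1) &&& (X t.2.1 &&& (X t.2.2 / 2))) else 0))

theorem rhsMask_testBit (b0 b1 hd : Γ) (n p0 W s : ℕ) (X : Option (Γ × Option Λ) → ℕ)
    (a : Option (Γ × Option Λ)) 
    (hp : 1 ≤ p0) (hW : p0 + s < W) (hs : n < 2 ^ s) (j : ℕ) :
    (rhsMask M b0 b1 hd n p0 W s X a).testBit j = true ↔
      (j < W ∧ iniF b0 b1 hd n p0 s j = a) ∨
      (∃ i, j = i + W ∧ a = none ∧ (X none).testBit i = true) ∨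
      (∃ i l m r, j = i + 1 + W ∧ a = caF M l m r ∧ (X l).testBit i = true ∧
        (X m).testBit (i+1) = true ∧ (X r).testBit (i+2) = true) := by
  simp only [rhsMask, Nat.testBit_or, Bool.or_eq_true, iniMask_testBit b0 b1 hd n p0 W s a hp hW hs j,
    orL_testBit, ite_testBit_aux, Nat.testBit_two_pow_mul, Nat.testBit_and, Nat.testBit_div_two,
    Bool.and_eq_true, decide_eq_true_eq, Finset.mem_toList, Finset.mem_univ, true_and]
  apply or_congr Iff.rfl
  apply or_congr
  · constructor
    · rintro ⟨h1, h2, h3⟩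
      exact ⟨j - W, by omega, h1, h3⟩
    · rintro ⟨i, rfl, h1, h2⟩
      exact ⟨h1, by omega, by simpa using h2⟩
  · constructor
    · rintro ⟨⟨l, m, r⟩, h1, h2, ⟨h3, h4⟩, h5, h6⟩
      refine ⟨j - W - 1, l, m, r, by omega, h1.symm, h4, ?_, ?_⟩
      · convert h5 using 2; omega
      · convert h6 using 2; omega
    · rintro ⟨i, l, m, r, rfl, h1, h2, h3, h4⟩
      refine ⟨⟨l, m, r⟩, h1.symm, by omega, ⟨by omega, ?_⟩, ?_, ?_⟩
      · convert h2 using 2; omega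
      · convert h3 using 2; omega
      · convert h4 using 2; omega

def Hlt (a : Option (Γ × Option Λ)) : Prop := ∃ g q, a = some (g, some q) ∧ M q g = none

theorem der_iff_mask (b0 b1 hd : Γ) (n p0 W s : ℕ)
    (hp : 1 ≤ p0) (hW : p0 + s < W) (hs : n < 2 ^ s) :
    (∃ i g q, Der M W (iniF b0 b1 hd n p0 s) i (some (g, some q)) ∧ M q g = none) ↔
      ∃ X : Option (Γ × Option Λ) → ℕ, (∀ a, Msk (X a) (rhsMask M b0 b1 hd n p0 W s X a)) ∧
        ∃ a, Hlt M a ∧ X a ≠ 0 := by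
  constructor
  · rintro ⟨i0, g, q, hd', hM⟩
    choose X hX using fun a => exists_mask (i0 + 1) (fun i => Der M W (iniF b0 b1 hd n p0 s) i a)
    refine ⟨X, fun a j hj => ?_, some (g, some q), ⟨g, q, rfl, hM⟩, ?_⟩
    · rw [hX] at hj
      rw [rhsMask_testBit M b0 b1 hd n p0 W s X a hp hW hs]
      obtain ⟨hj, hD⟩ := hj
      cases hD with
      | ini _ h => exact Or.inl ⟨h, rfl⟩
      | wall i h =>
        exact Or.inr (Or.inl ⟨i, rfl, rfl, (hX _ _).2 ⟨by omega, h⟩⟩)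
      | step i l m r hl hm hr =>
        exact Or.inr (Or.inr ⟨i, l, m, r, rfl, rfl, (hX _ _).2 ⟨by omega, hl⟩,
          (hX _ _).2 ⟨by omega, hm⟩, (hX _ _).2 ⟨by omega, hr⟩⟩)
    · intro h0
      have := (hX (some (g, some q)) i0).2 ⟨by omega, hd'⟩
      rw [h0] at this; simp at this
  · rintro ⟨X, hX, a, ⟨g, q, rfl, hM⟩, h0⟩
    have key : ∀ j a, (X a).testBit j = true → Der M W (iniF b0 b1 hd n p0 s) j a := by
      intro j
      induction j using Nat.strong_induction_on with
      | _ j ih =>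
        intro a ha
        have := hX a j ha
        rw [rhsMask_testBit M b0 b1 hd n p0 W s X a hp hW hs] at this
        rcases this with ⟨h1, rfl⟩ | ⟨i, rfl, rfl, h⟩ | ⟨i, l, m, r, rfl, rfl, hl, hm, hr⟩
        · exact Der.ini j h1
        · exact Der.wall i (ih i (by omega) _ h)
        · by_cases hW2 : 2 ≤ W
          · exact Der.step i l m r (ih i (by omega) _ hl) (ih _ (by omega) _ hm) (ih _ (by omega) _ hr)
          · omega
    obtain ⟨i, hi⟩ := Nat.exists_testBit_of_ne_zero h0
    exact ⟨i, g, q, key i _ hi, hM⟩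

theorem size_iff (n s : ℕ) : n.size = s ↔ n < 2 ^ s ∧ 2 ^ s ≤ 2 * n + 1 := by
  rw [← Nat.size_le]
  cases s with
  | zero => simp
  | succ s =>
    have : s < n.size ↔ 2 ^ s ≤ n := Nat.lt_size
    rw [pow_succ]
    omega

theorem halts_dioph (b0 b1 hd : Γ) :
    Dioph {v : Unit → ℕ | (StateTransition.eval (TM0.step M)
      (TM0.init (hd :: ((Nat.bits (v ())).map (fun b => cond b b1 b0)).reverse))).Dom} := by
  let A := Option (Γ × Option Λ)
  let V := Unit ⊕ (A ⊕ Fin 3)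
  have dn : DiophFn (fun v : V → ℕ => v (Sum.inl ())) := proj_dioph _
  have dX : ∀ a : A, DiophFn (fun v : V → ℕ => v (Sum.inr (Sum.inl a))) := fun a => proj_dioph _
  have dp : DiophFn (fun v : V → ℕ => v (Sum.inr (Sum.inr 0))) := proj_dioph _
  have dW : DiophFn (fun v : V → ℕ => v (Sum.inr (Sum.inr 1))) := proj_dioph _
  have ds : DiophFn (fun v : V → ℕ => v (Sum.inr (Sum.inr 2))) := proj_dioph _
  have c1 : DiophFn (fun v : V → ℕ => 1) := const_dioph 1
  have c2 : DiophFn (fun v : V → ℕ => 2) := const_dioph 2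
  have c0 : DiophFn (fun v : V → ℕ => 0) := const_dioph 0
  have dini : ∀ a : A, DiophFn (fun v : V → ℕ => iniMask b0 b1 hd (v (Sum.inl ()))
      (v (Sum.inr (Sum.inr 0))) (v (Sum.inr (Sum.inr 1))) (v (Sum.inr (Sum.inr 2))) a) := by
    intro a
    unfold iniMask
    refine lor_dioph (ite_dioph c1) (lor_dioph (ite_dioph ?_) (lor_dioph (ite_dioph ?_)
      (lor_dioph (ite_dioph ?_) (lor_dioph (ite_dioph ?_) (ite_dioph ?_)))))
    · exact mul_dioph dn (pow_dioph c2 dp)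
    · exact mul_dioph (sub_dioph (pow_dioph c2 ds) (add_dioph dn c1)) (pow_dioph c2 dp)
    · exact pow_dioph c2 (add_dioph dp ds)
    · exact sub_dioph (pow_dioph c2 dp) c2
    · exact sub_dioph (pow_dioph c2 dW) (pow_dioph c2 (add_dioph (add_dioph dp ds) c1))
  have drhs : ∀ a : A, DiophFn (fun v : V → ℕ => rhsMask M b0 b1 hd (v (Sum.inl ()))
      (v (Sum.inr (Sum.inr 0))) (v (Sum.inr (Sum.inr 1))) (v (Sum.inr (Sum.inr 2)))
      (fun a => v (Sum.inr (Sum.inl a))) a) := by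
    intro a
    unfold rhsMask
    refine lor_dioph (dini a) (lor_dioph (ite_dioph ?_) (orL_dioph _ _ fun t => ite_dioph ?_))
    · exact mul_dioph (pow_dioph c2 dW) (dX _)
    · exact mul_dioph (pow_dioph c2 dW) (land_dioph (mul_dioph (const_dioph (2 ^ 1)) (dX _))
        (land_dioph (dX _) (div_dioph (dX _) c2)))
  have dall := eq_dioph (orL_dioph (Finset.univ : Finset A).toList _ fun a =>
    sub_dioph (dX a) (land_dioph (dX a) (drhs a))) c0
  have dex := ne_dioph (orL_dioph (Finset.univ : Finset A).toList _ fun a =>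
    ite_dioph (c := Hlt M a) (dX a)) c0
  have dmain := (le_dioph c1 dp).inter <| (lt_dioph (add_dioph dp ds) dW).inter <|
    (lt_dioph dn (pow_dioph c2 ds)).inter <|
    (le_dioph (pow_dioph c2 ds) (add_dioph (mul_dioph c2 dn) c1)).inter <| dall.inter dex
  refine Dioph.ext (ex_dioph dmain) fun v => ?_
  rw [Set.mem_ofPred_eq, Set.mem_ofPred_eq, halts_iff']
  have mskeq : ∀ x y : ℕ, x - (x &&& y) = 0 ↔ Msk x y := by
    intro x y
    have : x - (x &&& y) = 0 ↔ x &&& y = x := by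
      have := Nat.and_le_left (n := x) (m := y)
      generalize x &&& y = s at *
      omega
    rw [this]
    constructor
    · intro h i hi
      rw [← h, Nat.testBit_and] at hi
      simp_all
    · intro h
      apply Nat.eq_of_testBit_eq
      intro i
      have := h i
      rw [Nat.testBit_and]
      cases hx : x.testBit i <;> simp_all
  have orne : ∀ X : A → ℕ, orL (Finset.univ : Finset A).toList (fun a => if Hlt M a then X a else 0) ≠ 0
      ↔ ∃ a, Hlt M a ∧ X a ≠ 0 := by
    intro X
    rw [Ne, orL_eq_zero]
    simp
    exact Iff.rfl
  constructor
  · rintro ⟨x, h1, h2, h3, h4, h5, h6⟩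
    have h1 : 1 ≤ x (Sum.inr 0) := h1
    have h2 : x (Sum.inr 0) + x (Sum.inr 2) < x (Sum.inr 1) := h2
    have h3 : v () < 2 ^ x (Sum.inr 2) := h3
    have h4 : 2 ^ x (Sum.inr 2) ≤ 2 * v () + 1 := h4
    have h5 := (orL_eq_zero _ _).1 h5
    have h6 := (orne (fun a => x (Sum.inl a))).1 h6
    have hs : (v ()).size = x (Sum.inr 2) := (size_iff _ _).2 ⟨h3, h4⟩
    rw [hs]
    have := (der_iff_mask M b0 b1 hd (v ()) (x (Sum.inr 0)) (x (Sum.inr 1)) (x (Sum.inr 2)) h1 h2 h3).2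
      ⟨fun a => x (Sum.inl a), fun a => (mskeq _ _).1 (h5 a (by simp)), h6⟩
    obtain ⟨i, g, q, hd1, hd2⟩ := this
    exact ⟨_, _, i, g, q, h1, h2, hd1, hd2⟩
  · rintro ⟨p0, W, i, g, q, h1, h2, hd1, hd2⟩
    obtain ⟨h3, h4⟩ := (size_iff (v ()) _).1 rfl
    obtain ⟨X, h5, h6⟩ := (der_iff_mask M b0 b1 hd (v ()) p0 W _ h1 h2 h3).1 ⟨i, g, q, hd1, hd2⟩
    refine ⟨Sum.elim X ![p0, W, (v ()).size], h1, h2, h3, h4, ?_, ?_⟩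
    · refine (orL_eq_zero _ _).2 fun a _ => (mskeq _ _).2 (h5 a)
    · exact (orne X).2 h6
end
end

section
section
open Turing Dioph

theorem exists_S : ∃ S : ℕ → Prop, ¬ ComputablePred S ∧ Dioph {v : Unit → ℕ | S (v ())} := by
  let f : ℕ →. ℕ := fun m => Nat.Partrec.Code.eval (Denumerable.ofNat Nat.Partrec.Code m) 0
  have hf : Nat.Partrec f := by
    have : Partrec f := Nat.Partrec.Code.eval_part.comp (Computable.ofNat _) (Computable.const 0)
    exact Partrec.nat_iff.1 this
  have hf' : Nat.Partrec' (fun v : List.Vector ℕ 1 => f v.head) :=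
    Nat.Partrec'.part_iff₁.2 (Partrec.nat_iff.2 hf)
  obtain ⟨c, hc⟩ := Turing.ToPartrec.Code.exists_code hf'
  have hc' : ∀ n, (c.eval [n]).Dom ↔ (f n).Dom := by
    intro n
    have := hc (n ::ᵥ List.Vector.nil)
    simp only [List.Vector.head_cons] at this
    change c.eval [n] = _ at this
    rw [this]
    rfl
  refine ⟨fun n => (f n).Dom, ?_, ?_⟩
  · intro h
    apply ComputablePred.halting_problem 0
    obtain ⟨g, hg, e⟩ := ComputablePred.computable_iff.1 h
    refine ComputablePred.computable_iff.2 ⟨fun c => g (Encodable.encode c), 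
      hg.comp Computable.encode, ?_⟩
    funext c
    have := congrFun e (Encodable.encode c)
    rw [← this]
    change _ = (Nat.Partrec.Code.eval (Denumerable.ofNat Nat.Partrec.Code (Encodable.encode c)) 0).Dom
    rw [Denumerable.ofNat_encode]
  · obtain ⟨Γ, Λ, i1, i2, i3, i4, M, b0, b1, hd, hM⟩ := exists_tm c
    have := Fintype.ofFinite Γ
    have := Fintype.ofFinite Λ
    refine Dioph.ext (halts_dioph M b0 b1 hd) fun v => ?_
    exact (hM (v ())).trans (hc' _)

theorem isPoly_mv {ι : Type} {f : (ι → ℕ) → ℤ} (h : IsPoly f) :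
    ∃ P Q : MvPolynomial ι ℕ, ∀ x, f x = (MvPolynomial.eval x P : ℤ) - (MvPolynomial.eval x Q : ℤ) := by
  induction h with
  | proj i => exact ⟨MvPolynomial.X i, 0, fun x => by simp⟩
  | const n =>
    refine ⟨MvPolynomial.C n.toNat, MvPolynomial.C (-n).toNat, fun x => ?_⟩
    simp
  | sub _ _ ih1 ih2 =>
    obtain ⟨P1, Q1, h1⟩ := ih1
    obtain ⟨P2, Q2, h2⟩ := ih2
    refine ⟨P1 + Q2, Q1 + P2, fun x => ?_⟩
    simp only [h1, h2]; simp; ring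
  | mul _ _ ih1 ih2 =>
    obtain ⟨P1, Q1, h1⟩ := ih1
    obtain ⟨P2, Q2, h2⟩ := ih2
    refine ⟨P1 * P2 + Q1 * Q2, P1 * Q2 + Q1 * P2, fun x => ?_⟩
    simp only [h1, h2]; simp; ring

theorem mv_list {N : ℕ} (P : MvPolynomial (Fin N) ℕ) :
    ∃ L : List (Fin N → ℕ), ∀ x, MvPolynomial.eval x P = (L.map (fun e => ∏ i, x i ^ e i)).sum := by
  induction P using MvPolynomial.induction_on' with
  | monomial u a =>
    refine ⟨List.replicate a u, fun x => ?_⟩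
    simp [MvPolynomial.eval_monomial, Finsupp.prod_fintype]
  | add p q hp hq =>
    obtain ⟨L1, h1⟩ := hp
    obtain ⟨L2, h2⟩ := hq
    exact ⟨L1 ++ L2, fun x => by simp [h1, h2]⟩

theorem list_bound {N : ℕ} (L : List (Fin N → ℕ)) : ∃ d, ∀ e ∈ L, ∀ i, e i ≤ d := by
  induction L with
  | nil => simp
  | cons e L ih =>
    obtain ⟨d, hd⟩ := ih
    refine ⟨d + ∑ i, e i, ?_⟩
    intro e' he' i
    rcases List.mem_cons.1 he' with rfl | h
    · have := Finset.single_le_sum (f := e') (fun i _ => Nat.zero_le _) (Finset.mem_univ i)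
      omega
    · have := hd e' h i
      omega

def monoEval {N d : ℕ} (x : Fin N → ℕ) (e : Fin N → Fin (d+1)) : ℕ := ∏ i, x i ^ (e i : ℕ)

theorem list_fin {N d : ℕ} (L : List (Fin N → ℕ)) (hd : ∀ e ∈ L, ∀ i, e i ≤ d) (x : Fin N → ℕ) :
    ((L.map (fun e i => Fin.ofNat (d+1) (e i))).map (monoEval x)).sum =
      (L.map (fun e => ∏ i, x i ^ e i)).sum := by
  rw [List.map_map]
  congr 1
  apply List.map_congr_left
  intro e he
  simp only [Function.comp, monoEval]
  apply Finset.prod_congr rfl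
  intro i _
  have := hd e he i
  rw [Fin.val_ofNat, Nat.mod_eq_of_lt (by omega)]

theorem exists_poly : ∃ S : ℕ → Prop, ¬ ComputablePred S ∧
    ∃ (m d : ℕ) (P Q : List (Fin (m+1) → Fin (d+1))), ∀ n, S n ↔
      ∃ k : Fin m → ℕ, (P.map (monoEval (Fin.cons n k : Fin (m+1) → ℕ))).sum =
        (Q.map (monoEval (Fin.cons n k : Fin (m+1) → ℕ))).sum := by
  classical
  obtain ⟨S, hS, β, ⟨p, hp⟩, hD⟩ := exists_S
  refine ⟨S, hS, ?_⟩
  obtain ⟨P, Q, hPQ⟩ := isPoly_mv hp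
  have hD' : ∀ n, S n ↔ ∃ t : β → ℕ, MvPolynomial.eval (Sum.elim (fun _ => n) t) P =
      MvPolynomial.eval (Sum.elim (fun _ => n) t) Q := by
    intro n
    refine (hD (fun _ => n)).trans (exists_congr fun t => ?_)
    change p (Sum.elim (fun _ => n) t) = 0 ↔ _
    rw [hPQ]
    omega
  let s : Finset β := (P.vars ∪ Q.vars).toRight
  let e : s ≃ Fin s.card := s.equivFin
  let j : Unit ⊕ β → Fin (s.card + 1) := Sum.elim (fun _ => 0)
    (fun b => if h : b ∈ s then (e ⟨b, h⟩).succ else 0)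
  obtain ⟨L1, h1⟩ := mv_list (MvPolynomial.rename j P)
  obtain ⟨L2, h2⟩ := mv_list (MvPolynomial.rename j Q)
  obtain ⟨d1, hd1⟩ := list_bound L1
  obtain ⟨d2, hd2⟩ := list_bound L2
  refine ⟨s.card, d1 + d2, L1.map (fun e i => Fin.ofNat (d1+d2+1) (e i)),
    L2.map (fun e i => Fin.ofNat (d1+d2+1) (e i)), fun n => (hD' n).trans ?_⟩
  have c : ∀ k, ((L1.map (fun e i => Fin.ofNat (d1+d2+1) (e i))).map (monoEval (Fin.cons n k : Fin (s.card+1) → ℕ))).sum =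
        ((L2.map (fun e i => Fin.ofNat (d1+d2+1) (e i))).map (monoEval (Fin.cons n k : Fin (s.card+1) → ℕ))).sum ↔
      MvPolynomial.eval ((Fin.cons n k : Fin (s.card+1) → ℕ) ∘ j) P =
      MvPolynomial.eval ((Fin.cons n k : Fin (s.card+1) → ℕ) ∘ j) Q := by
    intro k
    rw [list_fin L1 (fun e he i => (hd1 e he i).trans (by omega)),
      list_fin L2 (fun e he i => (hd2 e he i).trans (by omega)), ← h1, ← h2,
      MvPolynomial.eval_rename, MvPolynomial.eval_rename]
  simp only [c]
  constructor
  · rintro ⟨t, ht⟩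
    refine ⟨fun i => t (e.symm i), ?_⟩
    have key : ∀ R : MvPolynomial (Unit ⊕ β) ℕ, R.vars ⊆ P.vars ∪ Q.vars →
        MvPolynomial.eval ((Fin.cons n (fun i => t (e.symm i)) : Fin (s.card+1) → ℕ) ∘ j) R =
        MvPolynomial.eval (Sum.elim (fun _ => n) t) R := by
      intro R hR
      apply MvPolynomial.eval₂Hom_congr' rfl _ rfl
      intro i hi _
      rcases i with i | b
      · simp [j]
      · have : b ∈ s := by simpa [s] using hR hi
        simp [j, this]
    rw [key P Finset.subset_union_left, key Q Finset.subset_union_right, ht]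
  · rintro ⟨k, hk⟩
    refine ⟨fun b => (Fin.cons n k : Fin (s.card+1) → ℕ) (j (Sum.inr b)), ?_⟩
    have : Sum.elim (fun _ => n) (fun b => (Fin.cons n k : Fin (s.card+1) → ℕ) (j (Sum.inr b)))
      = (Fin.cons n k : Fin (s.card+1) → ℕ) ∘ j := by
      funext i
      rcases i with i | b
      · simp [j]
      · rfl
    rw [this, hk]
end
end

section
section

def actW {D : Type} (f : Bool → D → List D) : List Bool → List D → List D
  | [], l => l
  | b :: w, l => actW f w (l.flatMap (f b))

section
variable {D : Type} (f : Bool → D → List D)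

theorem actW_append (x y : List Bool) (l : List D) : actW f (x ++ y) l = actW f y (actW f x l) := by
  induction x generalizing l with
  | nil => rfl
  | cons b x ih => simp [actW, ih]

theorem actW_flat (w : List Bool) (l : List D) : actW f w l = l.flatMap (fun d => actW f w [d]) := by
  induction w generalizing l with
  | nil => simp [actW]
  | cons b w ih =>
    rw [actW, ih, List.flatMap_assoc]
    congr 1
    funext d
    rw [actW, ← ih]
    simp

theorem actW_mem {T : Set D} (hT : ∀ b, ∀ x ∈ T, ∀ y ∈ f b x, y ∈ T) (w : List Bool) (l : List D)
    (hl : ∀ x ∈ l, x ∈ T) : ∀ y ∈ actW f w l, y ∈ T := by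
  induction w generalizing l with
  | nil => exact hl
  | cons b w ih =>
    apply ih
    intro y hy
    obtain ⟨x, hx, hy⟩ := List.mem_flatMap.1 hy
    exact hT b x (hl x hx) y hy
end

/-- the letters -/
inductive Ltr : Type
  | a | p | q | z
  | lev (e : ℕ) (es : List ℕ) (s : Bool)

namespace Ltr

def nxt (s : Bool) : List ℕ → Ltr
  | [] => z
  | e :: es => lev e es s

def f (PL QL : List (List ℕ)) : Bool → Ltr → List Ltr
  | false, a => [q]
  | false, p => []
  | false, q => []
  | false, z => [z]
  | false, lev e es s => (List.range (e+1)).flatMap (fun j => List.replicate (e.choose j) (lev j es s))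
  | true, a => [p]
  | true, p => PL.map (nxt true)
  | true, q => QL.map (nxt false)
  | true, z => []
  | true, lev e es s => if e = 0 then [nxt s es] else []

def blk : List Bool → ℕ → ℕ
  | [], _ => 0
  | false :: w, 0 => blk w 0 + 1
  | false :: w, t+1 => blk w (t+1)
  | true :: _, 0 => 0
  | true :: w, t+1 => blk w t

def pw : List ℕ → (ℕ → ℕ) → ℕ
  | [], _ => 1
  | e :: es, k => k 0 ^ e * pw es (fun t => k (t+1))

variable {PL QL : List (List ℕ)}

theorem act_z_zero (w : List Bool) (h : w.count true = 0) : actW (f PL QL) w [z] = [z] := by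
  induction w with
  | nil => rfl
  | cons b w ih =>
    cases b
    · simp at h
      simpa [actW, f] using ih (by simpa using h)
    · simp at h

theorem act_nil (w : List Bool) : actW (f PL QL) w [] = [] := by
  rw [actW_flat]; rfl

theorem act_false_lev (w : List Bool) (e : ℕ) (es : List ℕ) (s : Bool) :
    actW (f PL QL) (false :: w) [lev e es s] = (List.range (e+1)).flatMap (fun j =>
      (List.replicate (e.choose j) ()).flatMap fun _ => actW (f PL QL) w [lev j es s]) := by
  rw [actW, actW_flat]
  simp only [List.flatMap_cons, List.flatMap_nil, List.append_nil, f, List.flatMap_assoc]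
  congr 1
  funext j
  induction e.choose j with
  | zero => simp
  | succ n ih => simp [List.replicate_succ, ih]

theorem nxt_cons (s : Bool) (e : ℕ) (es : List ℕ) : nxt s (e :: es) = lev e es s := rfl

theorem act_true_lev (w : List Bool) (e : ℕ) (es : List ℕ) (s : Bool) :
    actW (f PL QL) (true :: w) [lev e es s] =
      if e = 0 then actW (f PL QL) w [nxt s es] else [] := by
  simp only [actW, List.flatMap_cons, List.flatMap_nil, List.append_nil, f]
  split_ifs
  · rfl
  · exact act_nil w

theorem sum_list_range (g : ℕ → ℕ) (n : ℕ) :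
    (List.map g (List.range n)).sum = ∑ j ∈ Finset.range n, g j := by
  induction n with
  | zero => rfl
  | succ n ih => rw [List.range_succ, Finset.sum_range_succ, ← ih]; simp

theorem act_eq (w : List Bool) (L : List ℕ) (s : Bool) (h : w.count true = L.length) :
    actW (f PL QL) w [nxt s L] = List.replicate (pw L (blk w)) z := by
  induction w generalizing L with
  | nil =>
    have : L = [] := by simpa [eq_comm] using h
    subst this; rfl
  | cons b w ih =>
    cases L with
    | nil => rw [nxt, act_z_zero _ h]; rfl
    | cons e es =>
      cases b
      · rw [nxt, act_false_lev]
        have : ∀ j, actW (f PL QL) w [lev j es s] = _ := fun j => ih (j :: es) (by simpa using h)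
        simp only [this]
        rw [List.eq_replicate_iff]
        constructor
        · simp only [List.length_flatMap, List.length_replicate, List.map_replicate,
            List.sum_replicate, pw, smul_eq_mul]
          have e1 : (fun t => blk (false :: w) (t+1)) = fun t => blk w (t+1) := rfl
          have e2 : blk (false :: w) 0 = blk w 0 + 1 := rfl
          rw [e1, e2, add_pow]
          rw [Finset.sum_mul, sum_list_range]
          refine Finset.sum_congr rfl fun j _ => ?_
          simp only [one_pow, mul_one, Nat.cast_id]
          ring
        · intro y hy
          simp only [List.mem_flatMap, List.mem_replicate] at hy
          tauto
      · have h' : w.count true = es.length := by simpa using h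
        have e1 : (fun t => blk (true :: w) (t+1)) = fun t => blk w t := rfl
        have e2 : blk (true :: w) 0 = 0 := rfl
        rw [nxt_cons, act_true_lev, pw, e1, e2]
        by_cases he : e = 0
        · simp [he, ih es h']
        · simp [he, act_nil]

theorem act_gt (w : List Bool) (L : List ℕ) (s : Bool) (h : L.length < w.count true) :
    actW (f PL QL) w [nxt s L] = [] := by
  induction w generalizing L with
  | nil => simp at h
  | cons b w ih =>
    cases L with
    | nil =>
      cases b
      · exact ih [] (by simpa using h)
      · exact act_nil w
    | cons e es =>
      cases b
      · rw [nxt, act_false_lev]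
        have : ∀ j, actW (f PL QL) w [lev j es s] = _ := fun j => ih (j :: es) (by simpa using h)
        simp only [this]
        simp
      · rw [nxt_cons, act_true_lev]
        by_cases he : e = 0
        · simp [he, ih es (by simpa using h)]
        · simp [he, act_nil]

theorem act_lt (w : List Bool) (L : List ℕ) (s : Bool) (h : w.count true < L.length) :
    ∀ y ∈ actW (f PL QL) w [nxt s L], ∃ e es, y = lev e es s := by
  induction w generalizing L with
  | nil =>
    cases L with
    | nil => simp at h
    | cons e es => simp [actW, nxt]
  | cons b w ih =>
    cases L with
    | nil => simp at h
    | cons e es =>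
      cases b
      · rw [nxt, act_false_lev]
        intro y hy
        simp only [List.mem_flatMap] at hy
        obtain ⟨j, _, _, _, hy⟩ := hy
        exact ih (j :: es) (by simpa using h) y hy
      · rw [nxt_cons, act_true_lev]
        by_cases he : e = 0
        · simp only [he, if_true]
          exact ih es (by simpa using h)
        · simp [he, act_nil]

theorem act_zero (w : List Bool) (N : ℕ) (s : Bool) (h : w.count true ≤ N) :
    nxt s (List.replicate (N - w.count true) 0) ∈ 
      actW (f PL QL) w [nxt s (List.replicate N 0)] := by
  induction w generalizing N with
  | nil => simp [actW]
  | cons b w ih =>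
    cases N with
    | zero =>
      rw [Nat.le_zero] at h
      simp only [List.replicate_zero, nxt, act_z_zero _ h, h]
      simp
    | succ N =>
      cases b
      · have := ih (N+1) (by simpa using h)
        simp only [List.replicate_succ, nxt, act_false_lev] at this ⊢
        simpa using this
      · have := ih N (by simpa using h)
        rw [List.replicate_succ, nxt_cons, act_true_lev, if_pos rfl]
        simpa using this

theorem pw_zero (N : ℕ) (k : ℕ → ℕ) : pw (List.replicate N 0) k = 1 := by
  induction N generalizing k with
  | zero => rfl
  | succ N ih => simp [List.replicate_succ, pw, ih]

theorem pw_ofFn {N : ℕ} (e : Fin N → ℕ) (k : ℕ → ℕ) :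
    pw (List.ofFn e) k = ∏ i : Fin N, k i ^ e i := by
  induction N generalizing k with
  | zero => simp [pw]
  | succ N ih =>
    rw [List.ofFn_succ, pw, ih, Fin.prod_univ_succ]
    simp

theorem blk_pre (n : ℕ) (w : List Bool) : blk (List.replicate n false ++ true :: w) 0 = n ∧
    ∀ t, blk (List.replicate n false ++ true :: w) (t+1) = blk w t := by
  induction n with
  | zero => simp [blk]
  | succ n ih => simp [List.replicate_succ, blk, ih]

def mkw : List ℕ → List Bool
  | [] => []
  | c :: cs => List.replicate c false ++ true :: mkw cs

theorem mkw_count (ks : List ℕ) : (mkw ks).count true = ks.length := by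
  induction ks with
  | nil => rfl
  | cons c cs ih => simp [mkw, ih, List.count_replicate]

theorem mkw_blk (ks : List ℕ) (t : ℕ) (h : t < ks.length) : blk (mkw ks) t = ks[t] := by
  induction ks generalizing t with
  | nil => simp at h
  | cons c cs ih =>
    cases t with
    | zero => exact (blk_pre c _).1
    | succ t =>
      rw [mkw, (blk_pre c _).2, ih t (by simpa using h)]; simp

theorem act_list_eq (w : List Bool) (LL : List (List ℕ)) (s : Bool) 
    (h : ∀ L ∈ LL, w.count true = L.length) :
    actW (f PL QL) w (LL.map (nxt s)) = List.replicate ((LL.map (fun L => pw L (blk w))).sum) z := by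
  induction LL with
  | nil => exact act_nil w
  | cons L LL ih =>
    rw [actW_flat]
    rw [actW_flat] at ih
    simp only [List.map_cons, List.flatMap_cons, ih (fun L hL => h L (by simp [hL])),
      act_eq w L s (h L (by simp)), List.sum_cons, List.replicate_add]

theorem act_list_gt (w : List Bool) (LL : List (List ℕ)) (s : Bool) 
    (h : ∀ L ∈ LL, L.length < w.count true) :
    actW (f PL QL) w (LL.map (nxt s)) = [] := by
  rw [actW_flat, List.flatMap_eq_nil_iff]
  intro d hd
  obtain ⟨L, hL, rfl⟩ := List.mem_map.1 hd
  exact act_gt w L s (h L hL)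

end Ltr
end
end

section
section
open MulOpposite

theorem transfer {D : Type} (f : Bool → D → List D) (T : Set D) (hfin : T.Finite)
    (hne : T.Nonempty) (hT : ∀ b, ∀ x ∈ T, ∀ y ∈ f b x, y ∈ T) (rk : D → ℕ)
    (hr : ∀ b, ∀ x ∈ T, ∀ y ∈ f b x, y = x ∨ rk x < rk y) :
    ∃ (k : ℕ) (g1 g2 : Monoid.End (FreeMonoid (Fin k))),
      0 < k ∧ IsUpperTriangular g1 ∧ IsUpperTriangular g2 ∧
      ∀ φ : FreeMonoid Bool →* (Monoid.End (FreeMonoid (Fin k)))ᵐᵒᵖ,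
        φ (FreeMonoid.of false) = MulOpposite.op g1 →
        φ (FreeMonoid.of true) = MulOpposite.op g2 →
        ∀ uv : List Bool × List Bool, 
          (∃ h ∈ Submonoid.closure ({g1, g2} : Set (Monoid.End (FreeMonoid (Fin k)))),
            φ (FreeMonoid.ofList uv.1) * MulOpposite.op h =
              φ (FreeMonoid.ofList uv.2) * MulOpposite.op h ∧
            φ (FreeMonoid.ofList uv.1) * MulOpposite.op h ≠ MulOpposite.op (oEnd (Fin k))) ↔
          ∃ w, (∀ x ∈ T, actW f (uv.1 ++ w) [x] = actW f (uv.2 ++ w) [x]) ∧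
            ∃ x ∈ T, actW f (uv.1 ++ w) [x] ≠ [] := by
  classical
  have := hfin.fintype
  have e : Fin (Fintype.card T) ≃ T := (Fintype.equivFin T).symm
  set k := Fintype.card T
  have hk : 0 < k := Fintype.card_pos_iff.2 hne.to_subtype
  let r : Fin k → ℕ := fun i => rk (e i)
  let σ : Fin k → D := fun i => (e (Tuple.sort r i) : D)
  have hσm : Monotone (fun i => rk (σ i)) := Tuple.monotone_sort r
  have hσT : ∀ i, σ i ∈ T := fun i => (e (Tuple.sort r i)).2
  have hσi : Function.Injective σ := fun i j h =>
    (Tuple.sort r).injective (e.injective (Subtype.ext h))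
  have hσs : ∀ x ∈ T, ∃ i, σ i = x := fun x hx =>
    ⟨(Tuple.sort r).symm (e.symm ⟨x, hx⟩), by simp [σ]⟩
  have : ∀ x, ∃ i, x ∈ T → σ i = x := fun x => by
    by_cases hx : x ∈ T
    · obtain ⟨i, hi⟩ := hσs x hx
      exact ⟨i, fun _ => hi⟩
    · exact ⟨⟨0, hk⟩, fun h => absurd h hx⟩
  choose τ hτ using this
  let g : Bool → Monoid.End (FreeMonoid (Fin k)) := fun b =>
    FreeMonoid.lift (fun x => FreeMonoid.ofList ((f b (σ x)).map τ))
  have hg : ∀ b l, (FreeMonoid.toList (g b (FreeMonoid.ofList l))).map σ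
      = (l.map σ).flatMap (f b) := by
    intro b l
    induction l with
    | nil => simp
    | cons x l ih =>
      rw [FreeMonoid.ofList_cons, map_mul, FreeMonoid.toList_mul, List.map_append, ih]
      simp only [List.map_cons, List.flatMap_cons]
      congr 1
      have hx : g b (FreeMonoid.of x) = FreeMonoid.ofList ((f b (σ x)).map τ) :=
        FreeMonoid.lift_eval_of _ _
      rw [hx, FreeMonoid.toList_ofList, List.map_map]
      conv_rhs => rw [← List.map_id (f b (σ x))]
      apply List.map_congr_left
      intro y hy
      exact hτ y (hT b _ (hσT x) y hy)
  have hut : ∀ b, IsUpperTriangular (g b) := by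
    intro b x y hyx hy
    have : σ y ∈ (FreeMonoid.toList (g b (FreeMonoid.ofList [x]))).map σ :=
      List.mem_map_of_mem hy
    rw [hg] at this
    simp only [List.map_cons, List.map_nil, List.flatMap_cons, List.flatMap_nil,
      List.append_nil] at this
    rcases hr b _ (hσT x) _ this with h | h
    · exact hyx.ne (hσi h)
    · exact absurd (hσm hyx.le) (not_le.2 h)
  refine ⟨k, g false, g true, hk, hut false, hut true, ?_⟩
  intro φ h1 h2 uv
  have hφ : ∀ b, φ (FreeMonoid.of b) = op (g b) := by
    intro b; cases b
    · exact h1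
    · exact h2
  have act : ∀ w l, (FreeMonoid.toList ((φ (FreeMonoid.ofList w)).unop (FreeMonoid.ofList l))).map σ
      = actW f w (l.map σ) := by
    intro w
    induction w with
    | nil => intro l; simp [actW]
    | cons b w ih =>
      intro l
      rw [FreeMonoid.ofList_cons, map_mul, unop_mul, hφ, unop_op, actW, ← hg]
      exact ih (FreeMonoid.toList (g b (FreeMonoid.ofList l)))
  have eqv : ∀ G : Monoid.End (FreeMonoid (Fin k)), ∀ G' : Monoid.End (FreeMonoid (Fin k)),
      G = G' ↔ ∀ i, (FreeMonoid.toList (G (FreeMonoid.ofList [i]))).map σ =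
        (FreeMonoid.toList (G' (FreeMonoid.ofList [i]))).map σ := by
    intro G G'
    constructor
    · rintro rfl i; rfl
    · intro h
      apply FreeMonoid.hom_eq
      intro i
      exact FreeMonoid.toList.injective (List.map_injective_iff.2 hσi (h i))
  have hcl : ∀ h, h ∈ Submonoid.closure ({g false, g true} : Set (Monoid.End (FreeMonoid (Fin k))))
      ↔ ∃ w, op h = φ (FreeMonoid.ofList w) := by
    intro h
    constructor
    · intro hh
      induction hh using Submonoid.closure_induction with
      | mem x hx =>
        rcases hx with rfl | rfl
        · exact ⟨[false], (hφ false).symm⟩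
        · exact ⟨[true], (hφ true).symm⟩
      | one => exact ⟨[], by simp⟩
      | mul x y _ _ ihx ihy =>
        obtain ⟨w, hw⟩ := ihx
        obtain ⟨w', hw'⟩ := ihy
        exact ⟨w' ++ w, by rw [op_mul, hw, hw', FreeMonoid.ofList_append, map_mul]⟩
    · rintro ⟨w, hw⟩
      have : h = (φ (FreeMonoid.ofList w)).unop := by rw [← hw, unop_op]
      rw [this]
      clear hw this
      induction w with
      | nil => simp
      | cons b w ih =>
        rw [FreeMonoid.ofList_cons, map_mul, unop_mul, hφ, unop_op]
        refine Submonoid.mul_mem _ ih (Submonoid.subset_closure ?_)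
        cases b <;> simp
  have heq : ∀ x y, φ (FreeMonoid.ofList x) = φ (FreeMonoid.ofList y) ↔
      ∀ d ∈ T, actW f x [d] = actW f y [d] := by
    intro x y
    rw [← unop_inj, eqv]
    simp only [act, List.map_cons, List.map_nil]
    constructor
    · intro h d hd
      obtain ⟨i, rfl⟩ := hσs d hd
      exact h i
    · intro h i
      exact h _ (hσT i)
  have ho : ∀ x, φ (FreeMonoid.ofList x) = op (oEnd (Fin k)) ↔ ∀ d ∈ T, actW f x [d] = [] := by
    intro x
    rw [← unop_inj, eqv]
    simp only [act, List.map_cons, List.map_nil, unop_op]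
    have : ∀ i : Fin k, List.map σ (FreeMonoid.toList (oEnd (Fin k) (FreeMonoid.ofList [i]))) = [] :=
      fun i => rfl
    simp only [this]
    constructor
    · intro h d hd
      obtain ⟨i, rfl⟩ := hσs d hd
      exact h i
    · intro h i
      exact h _ (hσT i)
  have hmul : ∀ x w, φ (FreeMonoid.ofList x) * φ (FreeMonoid.ofList w) =
      φ (FreeMonoid.ofList (x ++ w)) := by
    intro x w
    rw [FreeMonoid.ofList_append, map_mul]
  constructor
  · rintro ⟨h, hh, e1, e2⟩
    obtain ⟨w, hw⟩ := (hcl h).1 hh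
    rw [hw, hmul, hmul, heq] at e1
    rw [hw, hmul, Ne, ho] at e2
    push Not at e2
    exact ⟨w, e1, e2⟩
  · rintro ⟨w, e1, e2⟩
    refine ⟨(φ (FreeMonoid.ofList w)).unop, (hcl _).2 ⟨w, by simp⟩, ?_, ?_⟩
    · rw [op_unop, hmul, hmul, heq]
      exact e1
    · rw [op_unop, hmul, Ne, ho]
      push Not
      exact e2
end
end

section
section
namespace Ltr

/-- the finite alphabet -/
def TT (m d : ℕ) : Set Ltr := fun x => match x with
  | lev e es _ => e ≤ d ∧ es.length ≤ m ∧ ∀ c ∈ es, c ≤ d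
  | _ => True

def rk (m d : ℕ) : Ltr → ℕ
  | a => 0
  | p => 1
  | q => 1
  | z => 2 + (m+1) * (d+1)
  | lev e es _ => 2 + (m - es.length) * (d+1) + (d - e)

theorem TT_finite (m d : ℕ) : (TT m d).Finite := by
  have h1 : ({l : List (Fin (d+1)) | l.length ≤ m}).Finite := List.finite_length_le _ _
  have h2 := ((Set.finite_univ (α := Fin (d+1))).prod h1).prod (Set.finite_univ (α := Bool))
  refine ((h2.image (fun x => lev x.1.1 (x.1.2.map Fin.val) x.2)).union
    (Set.toFinite {a, p, q, z})).subset ?_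
  intro x hx
  cases x with
  | lev e es s =>
    left
    obtain ⟨he, hl, hc⟩ := hx
    refine ⟨((Fin.ofNat (d+1) e, es.map (Fin.ofNat (d+1))), s), by simpa using hl, ?_⟩
    have h3 : e % (d+1) = e := Nat.mod_eq_of_lt (by omega)
    have h4 : (es.map (Fin.ofNat (d+1))).map Fin.val = es := by
      rw [List.map_map]
      conv_rhs => rw [← List.map_id es]
      apply List.map_congr_left
      intro c hcc
      have := hc c hcc
      exact Nat.mod_eq_of_lt (by omega)
    simp only [h4]
    simp [h3]
  | _ => right; simp

variable {PL QL : List (List ℕ)} {m d : ℕ}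

theorem nxt_TT (s : Bool) (L : List ℕ) (h : L.length ≤ m+1) (h' : ∀ c ∈ L, c ≤ d) :
    nxt s L ∈ TT m d := by
  cases L with
  | nil => trivial
  | cons e es => exact ⟨h' e (by simp), by simpa using h, fun c hc => h' c (by simp [hc])⟩

theorem nxt_rk (s : Bool) (L : List ℕ) : 1 < rk m d (nxt s L) := by
  cases L <;> simp only [nxt, rk] <;> omega

theorem TT_closed (hP : ∀ L ∈ PL, L.length ≤ m+1 ∧ ∀ c ∈ L, c ≤ d)
    (hQ : ∀ L ∈ QL, L.length ≤ m+1 ∧ ∀ c ∈ L, c ≤ d) (b : Bool) :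
    ∀ x ∈ TT m d, ∀ y ∈ f PL QL b x, y ∈ TT m d ∧ (y = x ∨ rk m d x < rk m d y) := by
  intro x hx y hy
  cases b <;> cases x <;> simp only [f, List.mem_singleton, List.not_mem_nil, List.mem_map,
    List.mem_flatMap, List.mem_range, List.mem_replicate] at hy
  · subst hy; exact ⟨trivial, Or.inr (by simp [rk])⟩
  · subst hy; exact ⟨trivial, Or.inl rfl⟩
  · rename_i e es s
    obtain ⟨j, hj, _, rfl⟩ := hy
    obtain ⟨he, hl, hc⟩ := hx
    refine ⟨⟨by omega, hl, hc⟩, ?_⟩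
    by_cases hje : j = e
    · left; rw [hje]
    · right; simp only [rk]; omega
  · subst hy; exact ⟨trivial, Or.inr (by simp [rk])⟩
  · obtain ⟨L, hL, rfl⟩ := hy
    exact ⟨nxt_TT _ _ (hP L hL).1 (hP L hL).2, Or.inr (nxt_rk _ _)⟩
  · obtain ⟨L, hL, rfl⟩ := hy
    exact ⟨nxt_TT _ _ (hQ L hL).1 (hQ L hL).2, Or.inr (nxt_rk _ _)⟩
  · rename_i e es s
    obtain ⟨he, hl, hc⟩ := hx
    by_cases h0 : e = 0
    · rw [if_pos h0, List.mem_singleton] at hy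
      subst hy
      refine ⟨nxt_TT _ _ (by omega) hc, Or.inr ?_⟩
      cases es with
      | nil =>
        simp only [rk, nxt, List.length_nil]
        have : (m+1) * (d+1) = m * (d+1) + (d+1) := by ring
        have : (m - 0) * (d+1) = m * (d+1) := by simp
        omega
      | cons e' es =>
        simp only [rk, nxt, List.length_cons] at hl ⊢
        obtain ⟨c, hc⟩ : ∃ c, m = es.length + 1 + c := ⟨m - (es.length+1), by omega⟩
        have h1 : m - (es.length + 1) = c := by omega
        have h2 : m - es.length = c + 1 := by omega
        rw [h1, h2]
        have : (c+1) * (d+1) = c * (d+1) + (d+1) := by ring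
        omega
    · rw [if_neg h0] at hy; simp at hy

def uu (n : ℕ) : List Bool := true :: true :: (List.replicate n false ++ [true])
def vv (n : ℕ) : List Bool := false :: true :: (List.replicate n false ++ [true])

theorem comb (P' Q' : List (List ℕ)) (hPQ : PL = List.replicate (m+1) 0 :: P')
    (hQQ : QL = List.replicate (m+1) 0 :: Q')
    (hP : ∀ L ∈ PL, L.length = m+1) (hQ : ∀ L ∈ QL, L.length = m+1) (n : ℕ) (w : List Bool) :
    ((∀ x ∈ TT m d, actW (f PL QL) (uu n ++ w) [x] = actW (f PL QL) (vv n ++ w) [x]) ∧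
            ∃ x ∈ TT m d, actW (f PL QL) (uu n ++ w) [x] ≠ []) ↔
    (w.count true = m ∧ 
      (P'.map (fun L => pw L (blk (List.replicate n false ++ true :: w)))).sum = 
      (Q'.map (fun L => pw L (blk (List.replicate n false ++ true :: w)))).sum) := by
  set w' := List.replicate n false ++ true :: w with hw'
  have cw : w'.count true = w.count true + 1 := by
    simp [hw', List.count_replicate]
  have hu : uu n ++ w = true :: true :: w' := by simp [uu, hw']
  have hv : vv n ++ w = false :: true :: w' := by simp [vv, hw']
  rw [hu, hv]
  have ua : actW (f PL QL) (true :: true :: w') [a] = actW (f PL QL) w' (PL.map (nxt true)) := by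
    simp [actW, f]
  have va : actW (f PL QL) (false :: true :: w') [a] = actW (f PL QL) w' (QL.map (nxt false)) := by
    simp [actW, f]
  have other : m ≤ w.count true → ∀ x ∈ TT m d, x ≠ a →
      actW (f PL QL) (true :: true :: w') [x] = [] ∧ 
      actW (f PL QL) (false :: true :: w') [x] = [] := by
    intro hm x hx hxa
    cases x with
    | a => exact absurd rfl hxa
    | p =>
      constructor
      · have : actW (f PL QL) (true :: true :: w') [p] =
          actW (f PL QL) (true :: w') (PL.map (nxt true)) := by simp [actW, f]
        rw [this]
        apply act_list_gt
        intro L hL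
        rw [hP L hL, List.count_cons_self, cw]; omega
      · simp [actW, f, act_nil]
    | q =>
      constructor
      · have : actW (f PL QL) (true :: true :: w') [q] =
          actW (f PL QL) (true :: w') (QL.map (nxt false)) := by simp [actW, f]
        rw [this]
        apply act_list_gt
        intro L hL
        rw [hQ L hL, List.count_cons_self, cw]; omega
      · simp [actW, f, act_nil]
    | z =>
      exact ⟨act_gt _ [] true (by simp), act_gt _ [] true (by simp)⟩
    | lev e es s =>
      have hl : es.length ≤ m := hx.2.1
      refine ⟨act_gt _ (e :: es) s ?_, act_gt _ (e :: es) s ?_⟩ <;>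
      simp [cw] <;> omega
  rcases lt_trichotomy (w.count true) m with h | h | h
  · refine iff_of_false ?_ (fun hh => absurd hh.1 h.ne)
    rintro ⟨h1, -⟩
    have := h1 a trivial
    rw [ua, va] at this
    have mem : nxt true (List.replicate (m+1 - w'.count true) 0) ∈
        actW (f PL QL) w' (PL.map (nxt true)) := by
      rw [actW_flat, List.mem_flatMap]
      exact ⟨nxt true (List.replicate (m+1) 0), by simp [hPQ], act_zero w' (m+1) true (by omega)⟩
    rw [this, actW_flat, List.mem_flatMap] at mem
    obtain ⟨y, hy, hmem⟩ := mem
    obtain ⟨L, hL, rfl⟩ := List.mem_map.1 hy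
    obtain ⟨e, es, he⟩ := act_lt w' L false (by rw [hQ L hL]; omega) _ hmem
    obtain ⟨c, hc⟩ : ∃ c, m + 1 - w'.count true = c + 1 := ⟨m - w'.count true, by omega⟩
    rw [hc, List.replicate_succ, nxt_cons] at he
    simp at he
  · have pa : actW (f PL QL) w' (PL.map (nxt true)) =
        List.replicate (1 + (P'.map (fun L => pw L (blk w'))).sum) z := by
      rw [act_list_eq w' PL true (fun L hL => by rw [hP L hL]; omega)]
      rw [hPQ, List.map_cons, List.sum_cons, pw_zero]
    have qa : actW (f PL QL) w' (QL.map (nxt false)) =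
        List.replicate (1 + (Q'.map (fun L => pw L (blk w'))).sum) z := by
      rw [act_list_eq w' QL false (fun L hL => by rw [hQ L hL]; omega)]
      rw [hQQ, List.map_cons, List.sum_cons, pw_zero]
    rw [pa] at ua
    rw [qa] at va
    constructor
    · rintro ⟨h1, -⟩
      refine ⟨h, ?_⟩
      have := h1 a trivial
      rw [ua, va] at this
      have := congrArg List.length this
      simpa using this
    · rintro ⟨-, h1⟩
      constructor
      · intro x hx
        by_cases hxa : x = a
        · rw [hxa, ua, va, h1]
        · obtain ⟨h2, h3⟩ := other h.ge x hx hxa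
          rw [h2, h3]
      · refine ⟨a, trivial, ?_⟩
        rw [ua]
        simp
  · refine iff_of_false ?_ (fun hh => absurd hh.1 h.ne')
    rintro ⟨-, x, hx, h1⟩
    apply h1
    by_cases hxa : x = a
    · rw [hxa, ua]
      exact act_list_gt w' PL true (fun L hL => by rw [hP L hL]; omega)
    · exact (other h.le x hx hxa).1

end Ltr
end
end

section
section
namespace Ltr
theorem primrec_rep : Primrec (fun n : ℕ => List.replicate n false ++ [true]) := by
  have h : Primrec (fun n : ℕ => Nat.rec (motive := fun _ => List Bool) [true]
      (fun _ l => false :: l) n) :=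
    Primrec.nat_rec₁ [true] (Primrec.list_cons.comp (Primrec.const false) Primrec.snd)
  refine h.of_eq fun n => ?_
  induction n with
  | zero => rfl
  | succ n ih => simp only [List.replicate_succ, List.cons_append, ← ih]

theorem computable_uv : Computable (fun n => (uu n, vv n)) := by
  apply Primrec.to_comp
  have h := Primrec.list_cons.comp (Primrec.const true) primrec_rep
  exact Primrec.pair (Primrec.list_cons.comp (Primrec.const true) h)
    (Primrec.list_cons.comp (Primrec.const false) h)

theorem pw_mono {m d : ℕ} (e : Fin (m+1) → Fin (d+1)) (n : ℕ) (w : List Bool) :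
    pw (List.ofFn (fun i => (e i : ℕ))) (blk (List.replicate n false ++ true :: w)) =
    monoEval (Fin.cons n (fun i : Fin m => blk w i) : Fin (m+1) → ℕ) e := by
  rw [pw_ofFn, monoEval]
  refine Finset.prod_congr rfl fun i _ => ?_
  refine Fin.cases ?_ (fun j => ?_) i
  · simp [(blk_pre n w).1]
  · simp [(blk_pre n w).2]
end Ltr
end
open Ltr in
theorem main_result :
    ∃ (k : ℕ) (g1 g2 : Monoid.End (FreeMonoid (Fin k))),
      0 < k ∧ IsUpperTriangular g1 ∧ IsUpperTriangular g2 ∧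
      ∀ φ : FreeMonoid Bool →* (Monoid.End (FreeMonoid (Fin k)))ᵐᵒᵖ,
        φ (FreeMonoid.of false) = MulOpposite.op g1 →
        φ (FreeMonoid.of true) = MulOpposite.op g2 →
        ¬ ComputablePred (fun uv : List Bool × List Bool =>
          ∃ h ∈ Submonoid.closure ({g1, g2} : Set (Monoid.End (FreeMonoid (Fin k)))),
            φ (FreeMonoid.ofList uv.1) * MulOpposite.op h =
              φ (FreeMonoid.ofList uv.2) * MulOpposite.op h ∧
            φ (FreeMonoid.ofList uv.1) * MulOpposite.op h ≠ MulOpposite.op (oEnd (Fin k))) := by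
  obtain ⟨S, hS, m, d, P, Q, hSP⟩ := exists_poly
  let c : List (Fin (m+1) → Fin (d+1)) → List (List ℕ) := fun P =>
    P.map (fun e => List.ofFn (fun i => (e i : ℕ)))
  have hc : ∀ P, ∀ L ∈ List.replicate (m+1) 0 :: c P, L.length = m+1 ∧ ∀ x ∈ L, x ≤ d := by
    intro P L hL
    rcases List.mem_cons.1 hL with rfl | hL
    · refine ⟨by simp, fun x hx => ?_⟩
      rw [(List.mem_replicate.1 hx).2]; exact Nat.zero_le _
    · obtain ⟨e, _, rfl⟩ := List.mem_map.1 hL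
      refine ⟨by simp, fun x hx => ?_⟩
      obtain ⟨i, rfl⟩ := (List.mem_ofFn' _ _).1 hx
      have := (e i).2
      simp only
      omega
  have hcl := TT_closed (m := m) (d := d) (fun L hL => ⟨(hc P L hL).1.le, (hc P L hL).2⟩)
    (fun L hL => ⟨(hc Q L hL).1.le, (hc Q L hL).2⟩)
  obtain ⟨k, g1, g2, hk, t1, t2, H⟩ := transfer _ (TT m d) (TT_finite m d) ⟨z, trivial⟩
    (fun b x hx y hy => (hcl b x hx y hy).1) (rk m d) (fun b x hx y hy => (hcl b x hx y hy).2)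
  refine ⟨k, g1, g2, hk, t1, t2, fun φ h1 h2 hcomp => hS ?_⟩
  have key : ∀ n, S n ↔ ∃ h ∈ Submonoid.closure ({g1, g2} : Set (Monoid.End (FreeMonoid (Fin k)))),
            φ (FreeMonoid.ofList (uu n)) * MulOpposite.op h =
              φ (FreeMonoid.ofList (vv n)) * MulOpposite.op h ∧
            φ (FreeMonoid.ofList (uu n)) * MulOpposite.op h ≠ MulOpposite.op (oEnd (Fin k)) := by
    intro n
    rw [H φ h1 h2 (uu n, vv n), hSP]
    simp only [comb (d := d) (c P) (c Q) rfl rfl (fun L hL => (hc P L hL).1)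
      (fun L hL => (hc Q L hL).1) n]
    have hm : ∀ (P : List (Fin (m+1) → Fin (d+1))) (w : List Bool),
        ((c P).map (fun L => pw L (blk (List.replicate n false ++ true :: w)))).sum =
        (P.map (monoEval (Fin.cons n (fun i : Fin m => blk w i) : Fin (m+1) → ℕ))).sum := by
      intro P w
      simp only [c, List.map_map]
      congr 2
      funext e
      exact pw_mono e n w
    simp only [hm]
    constructor
    · rintro ⟨k, hk⟩
      refine ⟨mkw (List.ofFn k), by rw [mkw_count]; simp, ?_⟩
      have : (fun i : Fin m => blk (mkw (List.ofFn k)) i) = k := by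
        funext i
        rw [mkw_blk _ _ (by simp)]
        simp
      rw [this]; exact hk
    · rintro ⟨w, -, hw⟩
      exact ⟨_, hw⟩
  obtain ⟨F, hF, he⟩ := ComputablePred.computable_iff.1 hcomp
  refine ComputablePred.computable_iff.2 ⟨fun n => F (uu n, vv n), hF.comp computable_uv, ?_⟩
  funext n
  rw [← congrFun he (uu n, vv n)]
  exact propext (key n)
end

/-- undecidability of the existence of a nonannihilating solution of
`a x = b x` over the monoid generated by two upper triangular free monoid
endomorphisms.  Since endomorphisms are applied on the right and composed
left-to-right in the paper, the monoid `End(D*)` of the paper is the multiplicative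
opposite of Mathlib's `Monoid.End`, and `φ` is a homomorphism into that opposite. -/
theorem statement9 :
    ∃ (k : ℕ) (g1 g2 : Monoid.End (FreeMonoid (Fin k))),
      0 < k ∧ IsUpperTriangular g1 ∧ IsUpperTriangular g2 ∧
      ∀ φ : FreeMonoid Bool →* (Monoid.End (FreeMonoid (Fin k)))ᵐᵒᵖ,
        φ (FreeMonoid.of false) = MulOpposite.op g1 →
        φ (FreeMonoid.of true) = MulOpposite.op g2 →
        ¬ ComputablePred (fun uv : List Bool × List Bool =>
          ∃ h ∈ Submonoid.closure ({g1, g2} : Set (Monoid.End (FreeMonoid (Fin k)))),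
            φ (FreeMonoid.ofList uv.1) * MulOpposite.op h =
              φ (FreeMonoid.ofList uv.2) * MulOpposite.op h ∧
            φ (FreeMonoid.ofList uv.1) * MulOpposite.op h ≠ MulOpposite.op (oEnd (Fin k))) := by
  exact main_result
end

section
/- There exist a positive integer k and upper triangular k×k matrices M1, M2 with nonnegative integer entries such that, writing M for the multiplicative submonoid of the k×k matrices generated by M1 and M2, O for the zero matrix, and φ for the monoid homomorphism from the free monoid {1,2}* to the k×k matrices sending 1 to M1 and 2 to M2, the set of pairs of words (u,v) over {1,2} for which there exists a matrix N ∈ M with φ(u) N = φ(v) N ≠ O is not a decidable (computable) predicate on pairs of words. -/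
/-- A square matrix over ℕ is upper triangular if every entry below the diagonal is zero. -/
def MatrixUpperTriangular {k : ℕ} (M : Matrix (Fin k) (Fin k) ℕ) : Prop :=
  ∀ i j : Fin k, j < i → M i j = 0

namespace S13
open Nat

lemma choose_eq_digit (n k : ℕ) :
    n.choose k = (2 ^ (n + 1) + 1) ^ n / (2 ^ (n + 1)) ^ k % 2 ^ (n + 1) := by
  have hB : 1 < 2 ^ (n + 1) := Nat.one_lt_two_pow (by omega)
  set B := 2 ^ (n + 1) with hBdef
  have hlt : ∀ i, n.choose i < B := fun i =>
    lt_of_le_of_lt (Nat.choose_le_two_pow n i) (Nat.pow_lt_pow_right (by omega) (by omega))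
  have hsum : ∀ s m : ℕ, (∑ i ∈ Finset.range m, n.choose (s + i) * B ^ i) / B ^ (m-1) < B ∧
      (∑ i ∈ Finset.range m, n.choose (s + i) * B ^ i) < B ^ m := by
    intro s m
    have : (∑ i ∈ Finset.range m, n.choose (s + i) * B ^ i) < B ^ m := by
      induction m with
      | zero => simp
      | succ m ih =>
        rw [Finset.sum_range_succ, pow_succ]
        have h1 := Nat.mul_le_mul_right (B ^ m) (Nat.succ_le_of_lt (hlt (s + m)))
        nlinarith
    refine ⟨?_, this⟩
    rcases m with _ | m
    · simp; omega
    · rw [Nat.div_lt_iff_lt_mul (by positivity)]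
      simpa [pow_succ, mul_comm] using this
  have hex : (B + 1) ^ n = ∑ i ∈ Finset.range (n + 1 + k + 1), n.choose i * B ^ i := by
    rw [add_pow]
    rw [show n + 1 + k + 1 = (n + 1) + (k + 1) by ring, Finset.sum_range_add _ (n+1) (k+1)]
    rw [Finset.sum_eq_zero (s := Finset.range (k+1))]
    · simp only [one_pow, mul_one, add_zero]
      exact Finset.sum_congr rfl fun i _ => by ring_nf; simp [mul_comm]
    · intro i _
      rw [Nat.choose_eq_zero_of_lt (by omega)]; simp
  have hsplit : (B + 1) ^ n = ∑ i ∈ Finset.range k, n.choose i * B ^ i +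
      B ^ k * (n.choose k + B * ∑ i ∈ Finset.range (n + 1), n.choose (k + 1 + i) * B ^ i) := by
    rw [hex, show n + 1 + k + 1 = k + (1 + (n + 1)) by ring, Finset.sum_range_add,
      Finset.sum_range_add]
    simp only [Finset.range_one, Finset.sum_singleton, add_zero, Finset.mul_sum, mul_add]
    congr 1; congr 1
    · ring
    · exact Finset.sum_congr rfl fun i _ => by rw [show k + (1 + i) = k + 1 + i by ring]; ring
  have hlow := (hsum 0 k).2
  simp only [zero_add] at hlow
  rw [hsplit, Nat.add_mul_div_left _ _ (by positivity), Nat.div_eq_of_lt hlow, zero_add,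
    Nat.add_mul_mod_self_left, Nat.mod_eq_of_lt (hlt k)]

lemma factorial_eq_div (n r : ℕ) (hr : r = (n ^ n + 1) * n ^ 2 + n + 1) :
    n ! = r ^ n / r.choose n := by
  have hnr : n < r := by
    rw [hr]; exact Nat.lt_succ_of_le (Nat.le_add_left _ _)
  have hc : 0 < r.choose n := Nat.choose_pos hnr.le
  have hd := Nat.descFactorial_eq_factorial_mul_choose r n
  symm
  rw [Nat.div_eq_iff hc]
  have h1 : r.descFactorial n ≤ r ^ n := Nat.descFactorial_le_pow r n
  have h2 : (r - n) ^ n ≤ r.descFactorial n :=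
    le_trans (Nat.pow_le_pow_left (by omega) n) (Nat.pow_sub_le_descFactorial r n)
  have h3 : (r : ℤ) ^ n * (r - n ^ 2) ≤ (r - n) ^ n * r := by
    have hrp : (0 : ℝ) < r := by exact_mod_cast (by omega : 0 < r)
    have := one_add_mul_le_pow (a := -(n : ℝ) / r) (by
      rw [le_div_iff₀ hrp]
      have : (n : ℝ) ≤ r := by exact_mod_cast hnr.le
      nlinarith) n
    have e : (1 + -(n : ℝ) / r) = (r - n) / r := by field_simp; ring
    rw [e, div_pow, le_div_iff₀ (by positivity)] at this
    have e2 : (1 + (n : ℝ) * (-(n : ℝ) / r)) * (r : ℝ) ^ n * r = (r : ℝ) ^ n * (r - n ^ 2) := by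
      field_simp
      ring
    have := mul_le_mul_of_nonneg_right this hrp.le
    rw [e2] at this
    exact_mod_cast this
  have h4 : n ! ≤ n ^ n := Nat.factorial_le_pow n
  have h5 : (n ! + 1) * n ^ 2 < r := by
    rw [hr]
    have := Nat.mul_le_mul_right (n ^ 2) (Nat.add_le_add_right h4 1)
    omega
  have key : n ! * r ^ n < (n ! + 1) * (r - n) ^ n := by
    have hrp : (0 : ℤ) < r := by exact_mod_cast (by omega : 0 < r)
    have hpow : (0 : ℤ) < (r : ℤ) ^ n := by positivity
    zify [hnr.le]
    apply lt_of_mul_lt_mul_right _ hrp.le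
    have h5' : ((n ! : ℤ) + 1) * n ^ 2 < r := by exact_mod_cast h5
    have hf : (0 : ℤ) ≤ (n ! : ℤ) + 1 := by positivity
    calc (n ! : ℤ) * r ^ n * r < ((n ! : ℤ) + 1) * (r ^ n * (r - n ^ 2)) := by
          have := mul_lt_mul_of_pos_left h5' hpow
          nlinarith
      _ ≤ ((n ! : ℤ) + 1) * ((r - n) ^ n * r) := mul_le_mul_of_nonneg_left h3 hf
      _ = _ := by ring
  have hfp : 0 < n ! := Nat.factorial_pos n
  have k2 : n ! * r ^ n < n ! * ((n ! + 1) * r.choose n) := by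
    calc _ < _ := key
      _ ≤ (n ! + 1) * r.descFactorial n := Nat.mul_le_mul_left _ h2
      _ = _ := by rw [hd]; ring
  have k3 := lt_of_mul_lt_mul_left k2 (Nat.zero_le _)
  constructor
  · rw [← hd]; exact h1
  · rw [add_mul, one_mul] at k3; omega

open Dioph

section
variable {α : Type} {f g : (α → ℕ) → ℕ}

lemma choose_dioph (df : DiophFn f) (dg : DiophFn g) :
    DiophFn fun v => (f v).choose (g v) := by
  have dB : DiophFn fun v => 2 ^ (f v + 1) :=
    pow_dioph (const_dioph 2) (add_dioph df (const_dioph 1))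
  have := mod_dioph (div_dioph (pow_dioph (add_dioph dB (const_dioph 1)) df) (pow_dioph dB dg)) dB
  simp only [choose_eq_digit]
  exact this

lemma factorial_dioph (df : DiophFn f) : DiophFn fun v => (f v)! := by
  have dr : DiophFn fun v => (f v ^ f v + 1) * f v ^ 2 + f v + 1 :=
    add_dioph (add_dioph (mul_dioph (add_dioph (pow_dioph df df) (const_dioph 1))
      (pow_dioph df (const_dioph 2))) df) (const_dioph 1)
  have := div_dioph (pow_dioph dr df) (choose_dioph dr df)
  have e : (fun v => (f v)!) = fun v => ((f v ^ f v + 1) * f v ^ 2 + f v + 1) ^ f v /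
      ((f v ^ f v + 1) * f v ^ 2 + f v + 1).choose (f v) :=
    funext fun v => factorial_eq_div _ _ rfl
  rw [e]; exact this

end
end S13

namespace S13
open Nat Dioph

/-- the pairwise coprime moduli whose product is a binomial coefficient -/
def mk (Q k : ℕ) : ℕ := Q ! * (Q ! / (k + 1)) - 1

lemma mk_spec {Q k : ℕ} (hk : k < Q) :
    (k + 1) * (mk Q k + 1) = Q ! * Q ! := by
  have hd : (k + 1) ∣ Q ! := Nat.dvd_factorial (by omega) hk
  obtain ⟨e, he⟩ := hd
  have hpos : 0 < Q ! := Nat.factorial_pos Q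
  have he' : Q ! / (k + 1) = e := by rw [he]; exact Nat.mul_div_cancel_left _ (by omega)
  have hepos : 0 < e := by
    rcases Nat.eq_zero_or_pos e with h | h
    · subst h; omega
    · exact h
  unfold mk
  rw [he']
  have : 0 < Q ! * e := Nat.mul_pos hpos hepos
  rw [Nat.sub_add_cancel this]
  calc (k + 1) * (Q ! * e) = Q ! * ((k + 1) * e) := by ring
    _ = _ := by rw [← he]

lemma mk_mod {Q k c : ℕ} (hk : k < Q) (hc : c + 1 = Q ! * Q !) : c = mk Q k * (k + 1) + k := by
  have := mk_spec hk
  rw [← hc] at this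
  nlinarith

lemma mk_prime {Q k p : ℕ} (hk : k < Q) (hp : p.Prime) (h : p ∣ mk Q k) : Q < p := by
  by_contra hle
  have hd : p ∣ Q ! := Nat.dvd_factorial hp.pos (by omega)
  have hpos : 0 < Q ! * (Q ! / (k + 1)) :=
    Nat.mul_pos (Nat.factorial_pos Q) (Nat.div_pos (Nat.le_of_dvd (Nat.factorial_pos Q)
      (Nat.dvd_factorial (by omega) hk)) (by omega))
  have h2 : p ∣ mk Q k + 1 := by
    unfold mk
    rw [Nat.sub_add_cancel hpos]
    exact hd.mul_right _
  have := (Nat.dvd_add_right h).1 h2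
  exact hp.one_lt.ne' (Nat.dvd_one.1 this)

lemma mk_two_le {Q k : ℕ} (hQ : 3 ≤ Q) (hk : k < Q) : 2 ≤ mk Q k := by
  have h1 : 3 ≤ Q ! := le_trans hQ (Nat.self_le_factorial Q)
  have h2 : 0 < Q ! / (k + 1) := (Nat.div_pos (Nat.le_of_dvd (Nat.factorial_pos Q)
      (Nat.dvd_factorial (by omega) hk)) (by omega))
  have : 3 ≤ Q ! * (Q ! / (k + 1)) := le_trans h1 (Nat.le_mul_of_pos_right _ h2)
  unfold mk; omega

lemma mk_coprime {Q k l : ℕ} (hk : k < Q) (hl : l < Q) (hkl : k ≠ l) :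
    Nat.Coprime (mk Q k) (mk Q l) := by
  refine Nat.coprime_of_dvd fun p hp h1 h2 => hkl ?_
  have hc : (Q ! * (Q !) - 1) + 1 = Q ! * Q ! :=
    Nat.sub_add_cancel (Nat.mul_pos (Nat.factorial_pos Q) (Nat.factorial_pos Q))
  have e1 := mk_mod hk hc
  have e2 := mk_mod hl hc
  have hQ := mk_prime hk hp h1
  have m1 : (Q ! * (Q !) - 1) % p = k := by
    rw [e1, Nat.add_mod, Nat.mod_eq_zero_of_dvd (h1.mul_right _), zero_add, Nat.mod_mod,
      Nat.mod_eq_of_lt (by omega)]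
  have m2 : (Q ! * (Q !) - 1) % p = l := by
    rw [e2, Nat.add_mod, Nat.mod_eq_zero_of_dvd (h2.mul_right _), zero_add, Nat.mod_mod,
      Nat.mod_eq_of_lt (by omega)]
  omega

lemma choose_eq_prod {Q y c : ℕ} (hy : y ≤ Q) (hc : c + 1 = Q ! * Q !) :
    c.choose y = ∏ k ∈ Finset.range y, mk Q k := by
  have h := Nat.descFactorial_eq_factorial_mul_choose c y
  rw [Nat.descFactorial_eq_prod_range] at h
  have h2 : ∏ i ∈ Finset.range y, (c - i) = ∏ i ∈ Finset.range y, ((i + 1) * mk Q i) := by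
    refine Finset.prod_congr rfl fun i hi => ?_
    have := mk_mod (lt_of_lt_of_le (Finset.mem_range.1 hi) hy) hc
    rw [mul_comm]; omega
  rw [h2, Finset.prod_mul_distrib, Finset.prod_range_add_one_eq_factorial] at h
  exact (Nat.eq_of_mul_eq_mul_left (Nat.factorial_pos y) h).symm

lemma poly_congr {γ : Type} (p : Poly γ) (m : ℤ) (w w' : γ → ℕ)
    (h : ∀ i, (w i : ℤ) ≡ w' i [ZMOD m]) : p w ≡ p w' [ZMOD m] := by
  induction p using Poly.induction with
  | H1 i => exact h i
  | H2 n => exact Int.ModEq.refl _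
  | H3 f g hf hg => exact hf.sub hg
  | H4 f g hf hg => exact hf.mul hg

lemma poly_bound {γ : Type} (p : Poly γ) :
    ∃ b : (γ → ℕ) → ℕ, DiophFn b ∧ ∀ w w' : γ → ℕ, (∀ i, w i ≤ w' i) → (p w).natAbs ≤ b w' := by
  induction p using Poly.induction with
  | H1 i => exact ⟨fun w => w i, proj_dioph i, fun w w' h => by simpa using h i⟩
  | H2 n => exact ⟨_, const_dioph n.natAbs, fun w w' h => by simp⟩
  | H3 f g hf hg =>
    obtain ⟨b, hb, h⟩ := hf
    obtain ⟨b', hb', h'⟩ := hg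
    refine ⟨_, add_dioph hb hb', fun w w' hw => ?_⟩
    have := h w w' hw
    have := h' w w' hw
    rw [Poly.sub_apply]
    omega
  | H4 f g hf hg =>
    obtain ⟨b, hb, h⟩ := hf
    obtain ⟨b', hb', h'⟩ := hg
    refine ⟨_, mul_dioph hb hb', fun w w' hw => ?_⟩
    rw [Poly.mul_apply, Int.natAbs_mul]
    exact Nat.mul_le_mul (h w w' hw) (h' w w' hw)

lemma poly_fin {α β : Type} (p : Poly (α ⊕ β)) :
    ∃ (s : Finset β) (q : Poly (α ⊕ s)), ∀ v t, p (Sum.elim v t) =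
      q (Sum.elim v (fun i : s => t i)) := by
  classical
  have key : ∀ (s s' : Finset β) (hs : s ⊆ s') (q : Poly (α ⊕ s)), ∃ q' : Poly (α ⊕ s'),
      ∀ (v : α → ℕ) (t : β → ℕ), q (Sum.elim v (fun i : s => t i)) =
        q' (Sum.elim v (fun i : s' => t i)) := by
    intro s s' hs q
    refine ⟨q.map (Sum.map id (fun i => ⟨i.1, hs i.2⟩)), fun v t => ?_⟩
    rw [Poly.map_apply]
    congr 1
    funext i
    rcases i with i | i <;> rfl
  induction p using Poly.induction with
  | H1 i =>
    rcases i with i | i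
    · exact ⟨∅, Poly.proj (Sum.inl i), fun v t => rfl⟩
    · exact ⟨{i}, Poly.proj (Sum.inr ⟨i, by simp⟩), fun v t => rfl⟩
  | H2 n => exact ⟨∅, Poly.const n, fun v t => rfl⟩
  | H3 f g hf hg =>
    obtain ⟨s, q, h⟩ := hf
    obtain ⟨s', q', h'⟩ := hg
    obtain ⟨r, hr⟩ := key s (s ∪ s') Finset.subset_union_left q
    obtain ⟨r', hr'⟩ := key s' (s ∪ s') Finset.subset_union_right q'
    exact ⟨s ∪ s', r - r', fun v t => by
      rw [Poly.sub_apply, Poly.sub_apply, h, h', hr, hr']⟩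
  | H4 f g hf hg =>
    obtain ⟨s, q, h⟩ := hf
    obtain ⟨s', q', h'⟩ := hg
    obtain ⟨r, hr⟩ := key s (s ∪ s') Finset.subset_union_left q
    obtain ⟨r', hr'⟩ := key s' (s ∪ s') Finset.subset_union_right q'
    exact ⟨s ∪ s', r * r', fun v t => by
      rw [Poly.mul_apply, Poly.mul_apply, h, h', hr, hr']⟩

lemma dioph_fin {α : Type} {S : Set (α → ℕ)} (h : Dioph S) :
    ∃ (β : Type) (_ : Fintype β) (p : Poly (α ⊕ β)), ∀ v, v ∈ S ↔ ∃ t, p (Sum.elim v t) = 0 := by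
  classical
  obtain ⟨β, p, hp⟩ := h
  obtain ⟨s, q, hq⟩ := poly_fin p
  refine ⟨s, inferInstance, q, fun v => (hp v).trans ⟨?_, ?_⟩⟩
  · rintro ⟨t, ht⟩
    exact ⟨_, (hq v t).symm.trans ht⟩
  · rintro ⟨t, ht⟩
    refine ⟨fun i => if h : i ∈ s then t ⟨i, h⟩ else 0, ?_⟩
    have e : (fun i : s => (fun i => if h : i ∈ s then t ⟨i, h⟩ else 0) i.1) = t := by
      funext i
      simp
    have := hq v (fun i => if h : i ∈ s then t ⟨i, h⟩ else 0)
    rw [e] at this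
    rw [← ht]
    exact this

theorem bqt_iff {α β : Type} [Fintype β] (p : Poly (Option α ⊕ β))
    (b : (Option α ⊕ β → ℕ) → ℕ)
    (hb : ∀ w w' : Option α ⊕ β → ℕ, (∀ i, w i ≤ w' i) → (p w).natAbs ≤ b w')
    (v : α → ℕ) (y : ℕ) :
    (∀ k < y, ∃ t, p (Sum.elim (Option.elim' k v) t) = 0) ↔
    ∃ (u Q c N : ℕ) (a : β → ℕ), 3 ≤ Q ∧ y ≤ Q ∧
      b (Sum.elim (Option.elim' y v) (fun _ => u)) ≤ Q ∧ c + 1 = Q ! * Q ! ∧ N = c.choose y ∧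
      (∀ i, N ∣ (a i).descFactorial u) ∧ N ∣ (p (Sum.elim (Option.elim' c v) a)).natAbs := by
  constructor
  · intro h
    choose! t ht using h
    set u := (∑ k ∈ Finset.range y, ∑ i, t k i) + 1 with hu
    set Q := 3 + y + b (Sum.elim (Option.elim' y v) (fun _ => u)) with hQ
    have hyQ : y ≤ Q := by omega
    have hc : (Q ! * (Q !) - 1) + 1 = Q ! * Q ! :=
      Nat.sub_add_cancel (Nat.mul_pos (Nat.factorial_pos Q) (Nat.factorial_pos Q))
    set c := Q ! * (Q !) - 1 with hcdef
    have htu : ∀ k < y, ∀ i, t k i < u := by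
      intro k hk i
      have h1 : t k i ≤ ∑ i, t k i :=
        Finset.single_le_sum (f := fun i => t k i) (fun _ _ => Nat.zero_le _) (Finset.mem_univ i)
      have h2 : ∑ i, t k i ≤ ∑ k ∈ Finset.range y, ∑ i, t k i :=
        Finset.single_le_sum (f := fun k => ∑ i, t k i) (fun _ _ => Nat.zero_le _)
          (Finset.mem_range.2 hk)
      omega
    have hcop : ((Finset.range y : Finset ℕ) : Set ℕ).Pairwise
        (Function.onFun Nat.Coprime (mk Q)) := by
      intro k hk l hl hkl
      simp only [Finset.coe_range, Set.mem_Iio] at hk hl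
      exact mk_coprime (by omega) (by omega) hkl
    have hne : ∀ k ∈ Finset.range y, mk Q k ≠ 0 := by
      intro k hk
      have := mk_two_le (Q := Q) (k := k) (by omega) (by have := Finset.mem_range.1 hk; omega)
      omega
    have hcrt : ∀ i : β, ∃ a, ∀ k ∈ Finset.range y, a ≡ t k i [MOD mk Q k] := fun i =>
      ⟨_, (Nat.chineseRemainderOfFinset (fun k => t k i) (mk Q) (Finset.range y) hne hcop).2⟩
    choose a ha using hcrt
    have hdvd : ∀ z : ℕ, (∀ k < y, mk Q k ∣ z) → c.choose y ∣ z := by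
      intro z hz
      rw [choose_eq_prod hyQ hc]
      exact Finset.prod_dvd_of_isRelPrime
        (fun i hi j hj hij => Nat.coprime_iff_isRelPrime.1 (hcop hi hj hij))
        (fun k hk => hz k (Finset.mem_range.1 hk))
    refine ⟨u, Q, c, _, a, by omega, hyQ, by omega, hc, rfl, fun i => hdvd _ fun k hk => ?_,
      hdvd _ fun k hk => ?_⟩
    · rw [Nat.descFactorial_eq_prod_range]
      have hm := ha i k (Finset.mem_range.2 hk)
      have hd : mk Q k ∣ a i - t k i := by
        rcases le_total (t k i) (a i) with hle | hle
        · exact (Nat.modEq_iff_dvd' hle).1 hm.symm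
        · rw [Nat.sub_eq_zero_of_le hle]; exact dvd_zero _
      exact hd.trans (Finset.dvd_prod_of_mem (fun j => a i - j) (Finset.mem_range.2 (htu k hk i)))
    · rw [← Int.natCast_dvd]
      have := poly_congr p (mk Q k : ℤ) (Sum.elim (Option.elim' c v) a)
        (Sum.elim (Option.elim' k v) (t k)) (by
          rintro ((_ | j) | j)
          · have e := mk_mod (lt_of_lt_of_le hk hyQ) hc
            change (c : ℤ) ≡ (k : ℤ) [ZMOD _]
            rw [Int.natCast_modEq_iff, e]
            exact (Nat.modEq_iff_dvd' (Nat.le_add_left _ _)).2 (by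
              rw [Nat.add_sub_cancel]; exact dvd_mul_right _ _) |>.symm
          · exact Int.ModEq.refl _
          · exact Int.natCast_modEq_iff.2 (ha j k (Finset.mem_range.2 hk)))
      rw [ht k hk] at this
      exact Int.modEq_zero_iff_dvd.1 this
  · rintro ⟨u, Q, c, N, a, hQ3, hyQ, hbQ, hc, hN, ha, hp⟩ k hk
    have hkQ : k < Q := by omega
    have hm2 := mk_two_le hQ3 hkQ
    obtain ⟨q, hq, hqm⟩ := Nat.exists_prime_and_dvd (n := mk Q k) (by omega)
    have hQq := mk_prime hkQ hq hqm
    have hqN : q ∣ N := by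
      rw [hN, choose_eq_prod hyQ hc]
      exact hqm.trans (Finset.dvd_prod_of_mem _ (Finset.mem_range.2 hk))
    refine ⟨fun i => a i % q, ?_⟩
    have hlt : ∀ i, a i % q < u := by
      intro i
      have h1 := hqN.trans (ha i)
      rw [Nat.descFactorial_eq_prod_range] at h1
      obtain ⟨j, hj, hd⟩ := hq.prime.exists_mem_finset_dvd h1
      have hju := Finset.mem_range.1 hj
      rcases le_total j (a i) with hle | hle
      · have : j ≡ a i [MOD q] := (Nat.modEq_iff_dvd' hle).2 hd
        have h3 : j % q = a i % q := this
        have := Nat.mod_le j q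
        omega
      · have := Nat.mod_le (a i) q
        omega
    have hcong := poly_congr p (q : ℤ) (Sum.elim (Option.elim' c v) a)
        (Sum.elim (Option.elim' k v) (fun i => a i % q)) (by
          rintro ((_ | j) | j)
          · have e := mk_mod hkQ hc
            change (c : ℤ) ≡ (k : ℤ) [ZMOD _]
            rw [Int.natCast_modEq_iff, e]
            exact (Nat.modEq_iff_dvd' (Nat.le_add_left _ _)).2 (by
              rw [Nat.add_sub_cancel]; exact hqm.mul_right _) |>.symm
          · exact Int.ModEq.refl _
          · exact Int.natCast_modEq_iff.2 (Nat.mod_modEq _ _).symm)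
    have hbd := hb (Sum.elim (Option.elim' k v) (fun i => a i % q))
      (Sum.elim (Option.elim' y v) (fun _ => u)) (by
        rintro ((_ | j) | j)
        · exact hk.le
        · exact le_refl _
        · exact (hlt j).le)
    have h0 : (q : ℤ) ∣ p (Sum.elim (Option.elim' c v) a) :=
      Int.natCast_dvd.2 (hqN.trans hp)
    have h1 := (Int.modEq_zero_iff_dvd.2 h0)
    have h2 := Int.modEq_zero_iff_dvd.1 (hcong.symm.trans h1)
    exact Int.eq_zero_of_abs_lt_dvd h2 (by
      rw [Int.abs_eq_natAbs]
      exact_mod_cast (by omega : (p (Sum.elim (Option.elim' k v) (fun i => a i % q))).natAbs < q))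

lemma forall_dioph {α β : Type} [Fintype β] {S : β → Set (α → ℕ)} (h : ∀ i, Dioph (S i)) :
    Dioph {v | ∀ i, v ∈ S i} := by
  have := DiophList.forall ((Finset.univ : Finset β).toList.map S) (by
    rw [List.forall_iff_forall_mem]
    intro x hx
    obtain ⟨i, _, rfl⟩ := List.mem_map.1 hx
    exact h i)
  refine this.ext fun v => ?_
  simp [List.forall_iff_forall_mem]

lemma ball_var {α : Type} {S : Set (Option α → ℕ)} (h : Dioph S) :
    Dioph {w : Option α → ℕ | ∀ k < w none, Option.elim' k (w ∘ some) ∈ S} := by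
  obtain ⟨β, _, p, hp⟩ := dioph_fin h
  obtain ⟨b, hbd, hb⟩ := poly_bound p
  let X := Option α ⊕ (Fin 4 ⊕ β)
  let vu : X := Sum.inr (Sum.inl 0)
  let vQ : X := Sum.inr (Sum.inl 1)
  let vc : X := Sum.inr (Sum.inl 2)
  let vN : X := Sum.inr (Sum.inl 3)
  let vy : X := Sum.inl none
  let g1 : Option α ⊕ β → X := Sum.elim Sum.inl (fun _ => vu)
  let g2 : Option α ⊕ β → X := Sum.elim (fun o => match o with
    | none => vc
    | some i => Sum.inl (some i)) (fun i => Sum.inr (Sum.inr i))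
  have P := fun i : X => proj_dioph (α := X) i
  have d1 : Dioph {w : X → ℕ | 3 ≤ w vQ} := le_dioph (const_dioph 3) (P vQ)
  have d2 : Dioph {w : X → ℕ | w vy ≤ w vQ} := le_dioph (P vy) (P vQ)
  have d3 : Dioph {w : X → ℕ | b (w ∘ g1) ≤ w vQ} := le_dioph (reindex_diophFn g1 hbd) (P vQ)
  have dF := factorial_dioph (P vQ)
  have d4 : Dioph {w : X → ℕ | w vc + 1 = (w vQ)! * (w vQ)!} :=
    eq_dioph (add_dioph (P vc) (const_dioph 1)) (mul_dioph dF dF)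
  have d5 : Dioph {w : X → ℕ | w vN = (w vc).choose (w vy)} :=
    eq_dioph (P vN) (choose_dioph (P vc) (P vy))
  have d6 : Dioph {w : X → ℕ | ∀ i : β, w ∈ {w : X → ℕ |
      w vN ∣ (w (Sum.inr (Sum.inr i))).descFactorial (w vu)}} := by
    refine forall_dioph fun i => ?_
    simp only [Nat.descFactorial_eq_factorial_mul_choose]
    exact dvd_dioph (P vN) (mul_dioph (factorial_dioph (P vu)) (choose_dioph (P _) (P vu)))
  have d7 : Dioph {w : X → ℕ | w vN ∣ ((p.map g2) w).natAbs} :=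
    dvd_dioph (P vN) (abs_poly_dioph (p.map g2))
  have := ex_dioph (((((((d1.inter d2).inter d3).inter d4).inter d5).inter d6).inter d7))
  refine this.ext fun w => ?_
  have hw : Option.elim' (w none) (w ∘ some) = w := by
    funext i; rcases i with _ | i <;> rfl
  have key := bqt_iff p b hb (w ∘ some) (w none)
  simp only [Set.mem_ofPred_eq, hp]
  rw [key]
  simp only [Set.mem_inter_iff]
  have e1 : ∀ x : Fin 4 ⊕ β → ℕ, Sum.elim w x ∘ g1 =
      Sum.elim (Option.elim' (w none) (w ∘ some)) (fun _ => x (Sum.inl 0)) := by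
    intro x; rw [hw]; funext i; rcases i with i | i <;> rfl
  have e2 : ∀ x : Fin 4 ⊕ β → ℕ, (p.map g2) (Sum.elim w x) =
      p (Sum.elim (Option.elim' (x (Sum.inl 2)) (w ∘ some)) (fun i => x (Sum.inr i))) := by
    intro x; rw [Poly.map_apply]; congr 1; funext i; rcases i with (_ | i) | i <;> rfl
  constructor
  · rintro ⟨x, ⟨⟨⟨⟨⟨⟨h1, h2⟩, h3⟩, h4⟩, h5⟩, h6⟩, h7⟩⟩
    have h3 : b (Sum.elim w x ∘ g1) ≤ x (Sum.inl 1) := h3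
    have h7 : x (Sum.inl 3) ∣ ((p.map g2) (Sum.elim w x)).natAbs := h7
    rw [e1] at h3
    rw [e2] at h7
    exact ⟨x (Sum.inl 0), x (Sum.inl 1), x (Sum.inl 2), x (Sum.inl 3), fun i => x (Sum.inr i),
      h1, h2, h3, h4, h5, h6, h7⟩
  · rintro ⟨u, Q, c, N, a, h1, h2, h3, h4, h5, h6, h7⟩
    refine ⟨Sum.elim ![u, Q, c, N] a, ⟨⟨⟨⟨⟨⟨h1, h2⟩, ?_⟩, h4⟩, h5⟩, h6⟩, ?_⟩⟩
    · change b (Sum.elim w (Sum.elim ![u, Q, c, N] a) ∘ g1) ≤ Q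
      rw [e1]; exact h3
    · change N ∣ ((p.map g2) (Sum.elim w (Sum.elim ![u, Q, c, N] a))).natAbs
      rw [e2]; exact h7

/-- bounded universal quantification preserves Diophantine sets -/
lemma ball_dioph {α : Type} {P : (α → ℕ) → ℕ → Prop} {f : (α → ℕ) → ℕ}
    (h : Dioph {w : Option α → ℕ | P (w ∘ some) (w none)}) (df : DiophFn f) :
    Dioph {v | ∀ k < f v, P v k} :=
  (diophFn_comp1 (ball_var h) df).ext fun _ => Iff.rfl

lemma ex_dioph' {α : Type} {P : (α → ℕ) → ℕ → Prop}
    (h : Dioph {w : Option α → ℕ | P (w ∘ some) (w none)}) : Dioph {v | ∃ k, P v k} :=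
  (ex1_dioph h).ext fun _ => Iff.rfl

end S13

namespace S13
open Nat Dioph

section
variable {α : Type} {f g : (α → ℕ) → ℕ}

lemma pair_dioph (df : DiophFn f) (dg : DiophFn g) : DiophFn fun v => Nat.pair (f v) (g v) := by
  have c1 : DiophFn fun _ : α → ℕ => 1 := const_dioph 1
  have ds := sub_dioph c1 (sub_dioph c1 (sub_dioph dg df))
  have := add_dioph (mul_dioph (add_dioph (mul_dioph dg dg) df) ds)
    (mul_dioph (add_dioph (add_dioph (mul_dioph df df) df) dg) (sub_dioph c1 ds))
  have e : (fun v => Nat.pair (f v) (g v)) = fun v =>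
      (g v * g v + f v) * (1 - (1 - (g v - f v))) +
        (f v * f v + f v + g v) * (1 - (1 - (1 - (g v - f v)))) := by
    funext v
    unfold Nat.pair
    split_ifs with h
    · have h1 : 1 - (1 - (g v - f v)) = 1 := by omega
      simp [h1]
    · have h1 : 1 - (1 - (g v - f v)) = 0 := by omega
      simp [h1]
  rw [e]; exact this

lemma left_dioph (df : DiophFn f) : DiophFn fun v => (f v).unpair.1 := by
  have : Dioph {v : Option α → ℕ | ∃ b, Nat.pair (v none) b = f (v ∘ some)} :=
    ex_dioph' (P := fun v b => Nat.pair (v none) b = f (v ∘ some))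
      (eq_dioph (pair_dioph (proj_dioph (some none)) (proj_dioph none))
        (reindex_diophFn (fun a => some (some a)) df))
  refine Dioph.ext this fun v => ?_
  change (∃ b, Nat.pair (v none) b = f (v ∘ some)) ↔ (f (v ∘ some)).unpair.1 = v none
  constructor
  · rintro ⟨b, hb⟩
    rw [← hb, Nat.unpair_pair]
  · intro h
    exact ⟨(f (v ∘ some)).unpair.2, by rw [← h, Nat.pair_unpair]⟩

lemma right_dioph (df : DiophFn f) : DiophFn fun v => (f v).unpair.2 := by
  have : Dioph {v : Option α → ℕ | ∃ b, Nat.pair b (v none) = f (v ∘ some)} :=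
    ex_dioph' (P := fun v b => Nat.pair b (v none) = f (v ∘ some))
      (eq_dioph (pair_dioph (proj_dioph none) (proj_dioph (some none)))
        (reindex_diophFn (fun a => some (some a)) df))
  refine Dioph.ext this fun v => ?_
  change (∃ b, Nat.pair b (v none) = f (v ∘ some)) ↔ (f (v ∘ some)).unpair.2 = v none
  constructor
  · rintro ⟨b, hb⟩
    rw [← hb, Nat.unpair_pair]
  · intro h
    exact ⟨(f (v ∘ some)).unpair.1, by rw [← h, Nat.pair_unpair]⟩

lemma beta_dioph (df : DiophFn f) (dg : DiophFn g) : DiophFn fun v => Nat.beta (f v) (g v) :=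
  mod_dioph (left_dioph df) (add_dioph (mul_dioph (add_dioph dg (const_dioph 1)) (right_dioph df))
    (const_dioph 1))
end

/-- the graph of a partial function is Diophantine -/
def DGraph (f : ℕ →. ℕ) : Prop :=
  ∀ (α : Type) (s t : (α → ℕ) → ℕ), DiophFn s → DiophFn t → Dioph {v | t v ∈ f (s v)}

lemma beta_exists (s : ℕ → ℕ) (n : ℕ) : ∃ c, ∀ i < n, Nat.beta c i = s i := by
  refine ⟨Nat.unbeta ((List.range n).map s), fun i hi => ?_⟩
  have := Nat.beta_unbeta_coe ((List.range n).map s) ⟨i, by simpa using hi⟩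
  simpa using this

lemma prec_iff (f g : ℕ →. ℕ) (a n y : ℕ) :
    y ∈ (Nat.rec (f a) (fun y IH => IH.bind fun i => g (Nat.pair a (Nat.pair y i))) n : Part ℕ) ↔
    ∃ c, Nat.beta c 0 ∈ f a ∧
      (∀ k < n, Nat.beta c (k + 1) ∈ g (Nat.pair a (Nat.pair k (Nat.beta c k)))) ∧
      y = Nat.beta c n := by
  constructor
  · intro h
    have : ∃ s : ℕ → ℕ, s 0 ∈ f a ∧ (∀ k < n, s (k + 1) ∈ g (Nat.pair a (Nat.pair k (s k)))) ∧
        y = s n := by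
      induction n generalizing y with
      | zero => exact ⟨fun _ => y, h, by simp, rfl⟩
      | succ n ih =>
        obtain ⟨i, hi, hy⟩ := Part.mem_bind_iff.1 h
        obtain ⟨s, h0, hs, rfl⟩ := ih i hi
        refine ⟨fun k => if k = n + 1 then y else s k, by simpa using h0, fun k hk => ?_, by simp⟩
        rcases Nat.lt_succ_iff_lt_or_eq.1 hk with hk' | rfl
        · have := hs k hk'
          simp only [Nat.add_right_cancel_iff]
          rw [if_neg (by omega), if_neg (by omega)]
          exact this
        · simpa using hy
    obtain ⟨s, h0, hs, rfl⟩ := this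
    obtain ⟨c, hc⟩ := beta_exists s (n + 1)
    refine ⟨c, by rwa [hc 0 (by omega)], fun k hk => ?_, (hc n (by omega)).symm⟩
    rw [hc k (by omega), hc (k + 1) (by omega)]
    exact hs k hk
  · rintro ⟨c, h0, hs, rfl⟩
    induction n with
    | zero => exact h0
    | succ n ih =>
      exact Part.mem_bind_iff.2 ⟨_, ih fun k hk => hs k (by omega), hs n (by omega)⟩

theorem partrec_dgraph {f : ℕ →. ℕ} (hf : Nat.Partrec f) : DGraph f := by
  induction hf with
  | zero =>
    intro α s t ds dt
    refine (eq_dioph dt (const_dioph 0)).ext fun v => ?_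
    change t v = 0 ↔ t v ∈ Part.some 0
    simp
  | succ =>
    intro α s t ds dt
    refine (eq_dioph dt (add_dioph ds (const_dioph 1))).ext fun v => ?_
    change t v = s v + 1 ↔ t v ∈ Part.some (s v + 1)
    simp
  | left =>
    intro α s t ds dt
    refine (eq_dioph dt (left_dioph ds)).ext fun v => ?_
    change t v = (s v).unpair.1 ↔ t v ∈ Part.some (s v).unpair.1
    simp
  | right =>
    intro α s t ds dt
    refine (eq_dioph dt (right_dioph ds)).ext fun v => ?_
    change t v = (s v).unpair.2 ↔ t v ∈ Part.some (s v).unpair.2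
    simp
  | @pair f g _ _ hf hg =>
    intro α s t ds dt
    have := (hf α s _ ds (left_dioph dt)).inter (hg α s _ ds (right_dioph dt))
    refine this.ext fun v => ?_
    change ((t v).unpair.1 ∈ f (s v) ∧ (t v).unpair.2 ∈ g (s v)) ↔
      t v ∈ Nat.pair <$> f (s v) <*> g (s v)
    simp only [Seq.seq, Part.mem_bind_iff, Part.map_eq_map, Part.mem_map_iff]
    constructor
    · rintro ⟨h1, h2⟩
      exact ⟨_, ⟨_, h1, rfl⟩, _, h2, by simp⟩
    · rintro ⟨_, ⟨a, h1, rfl⟩, b, h2, h3⟩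
      rw [← h3]
      simpa using ⟨h1, h2⟩
  | @comp f g _ _ hf hg =>
    intro α s t ds dt
    have := ex_dioph' (P := fun v a => a ∈ g (s v) ∧ t v ∈ f a)
      ((hg (Option α) _ _ (reindex_diophFn some ds) (proj_dioph none)).inter
        (hf (Option α) _ _ (proj_dioph none) (reindex_diophFn some dt)))
    refine this.ext fun v => ?_
    change (∃ a, a ∈ g (s v) ∧ t v ∈ f a) ↔ t v ∈ (g (s v)).bind f
    exact Part.mem_bind_iff.symm
  | @prec f g _ _ hf hg =>
    intro α s t ds dt
    have R1 : ∀ {h : (α → ℕ) → ℕ}, DiophFn h → DiophFn fun w : Option α → ℕ => h (w ∘ some) :=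
      fun dh => reindex_diophFn some dh
    have R2 : ∀ {h : (α → ℕ) → ℕ}, DiophFn h →
        DiophFn fun w : Option (Option α) → ℕ => h ((w ∘ some) ∘ some) :=
      fun dh => reindex_diophFn (fun a => some (some a)) dh
    have dc1 : DiophFn fun w : Option α → ℕ => w none := proj_dioph none
    have dc2 : DiophFn fun w : Option (Option α) → ℕ => w (some none) := proj_dioph _
    have dk2 : DiophFn fun w : Option (Option α) → ℕ => w none := proj_dioph _
    have A1 := hf (Option α) _ _ (R1 (left_dioph ds)) (beta_dioph dc1 (const_dioph 0))
    have A2 := hg (Option (Option α)) _ _ (pair_dioph (R2 (left_dioph ds))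
      (pair_dioph dk2 (beta_dioph dc2 dk2))) (beta_dioph dc2 (add_dioph dk2 (const_dioph 1)))
    have A3 := ball_dioph (P := fun (w : Option α → ℕ) k => Nat.beta (w none) (k + 1) ∈
      g (Nat.pair (s (w ∘ some)).unpair.1 (Nat.pair k (Nat.beta (w none) k)))) A2
      (R1 (right_dioph ds))
    have A4 := eq_dioph (R1 dt) (beta_dioph dc1 (R1 (right_dioph ds)))
    have := ex_dioph' (P := fun v c => Nat.beta c 0 ∈ f (s v).unpair.1 ∧
      (∀ k < (s v).unpair.2, Nat.beta c (k + 1) ∈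
        g (Nat.pair (s v).unpair.1 (Nat.pair k (Nat.beta c k)))) ∧
      t v = Nat.beta c (s v).unpair.2) (A1.inter (A3.inter A4))
    refine this.ext fun v => ?_
    exact (prec_iff f g _ _ _).symm
  | @rfind f _ hf =>
    intro α s t ds dt
    have R1 : ∀ {h : (α → ℕ) → ℕ}, DiophFn h → DiophFn fun w : Option α → ℕ => h (w ∘ some) :=
      fun dh => reindex_diophFn some dh
    have R2 : ∀ {h : (α → ℕ) → ℕ}, DiophFn h →
        DiophFn fun w : Option (Option α) → ℕ => h ((w ∘ some) ∘ some) :=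
      fun dh => reindex_diophFn (fun a => some (some a)) dh
    have A1 := hf α _ _ (pair_dioph ds dt) (const_dioph 0)
    have dk : DiophFn fun w : Option (Option α) → ℕ => w (some none) := proj_dioph _
    have dz : DiophFn fun w : Option (Option α) → ℕ => w none := proj_dioph _
    have A2 := (ne_dioph dz (const_dioph 0)).inter
      (hf (Option (Option α)) _ _ (pair_dioph (R2 ds) dk) dz)
    have A3 := ex_dioph' (P := fun (w : Option α → ℕ) z => z ≠ 0 ∧
      z ∈ f (Nat.pair (s (w ∘ some)) (w none))) A2
    have A4 := ball_dioph (P := fun v k => ∃ z, z ≠ 0 ∧ z ∈ f (Nat.pair (s v) k)) A3 dt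
    refine (A1.inter A4).ext fun v => ?_
    change (0 ∈ f (Nat.pair (s v) (t v)) ∧ ∀ k < t v, ∃ z, z ≠ 0 ∧ z ∈ f (Nat.pair (s v) k)) ↔ _
    change _ ↔ t v ∈ Nat.rfind fun n => (fun m => decide (m = 0)) <$> f (Nat.pair (s v) n)
    refine Iff.trans ?_ Nat.mem_rfind.symm
    constructor
    · rintro ⟨h1, h2⟩
      refine ⟨(Part.mem_map_iff _).2 ⟨0, h1, by simp⟩, fun {m} hm => ?_⟩
      obtain ⟨z, hz, hz'⟩ := h2 m hm
      exact (Part.mem_map_iff _).2 ⟨z, hz', by simpa using hz⟩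
    · rintro ⟨h1, h2⟩
      obtain ⟨z, hz, hz0⟩ := (Part.mem_map_iff _).1 h1
      refine ⟨?_, fun k hk => ?_⟩
      · have : z = 0 := by simpa using hz0
        rwa [← this]
      · obtain ⟨z, hz, hz0⟩ := (Part.mem_map_iff _).1 (h2 hk)
        exact ⟨z, by simpa using hz0, hz⟩

/-- a Diophantine set with undecidable membership problem -/
theorem exists_undecidable_poly : ∃ (β : Type) (_ : Fintype β) (p : Poly (Unit ⊕ β)),
    ¬ ComputablePred fun x : ℕ => ∃ t : β → ℕ, p (Sum.elim (fun _ => x) t) = 0 := by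
  let F : ℕ →. ℕ := fun x => Nat.Partrec.Code.eval (Denumerable.ofNat Nat.Partrec.Code x) 0
  have hF : Nat.Partrec F := by
    rw [← Partrec.nat_iff]
    exact Nat.Partrec.Code.eval_part.comp (Computable.ofNat Nat.Partrec.Code)
      (Computable.const 0)
  have hG := partrec_dgraph hF
  have hD : Dioph {v : Unit → ℕ | ∃ y, y ∈ F (v ())} :=
    ex_dioph' (P := fun v y => y ∈ F (v ()))
      (hG _ _ _ (proj_dioph (some ())) (proj_dioph none))
  obtain ⟨β, hβ, p, hp⟩ := dioph_fin hD
  refine ⟨β, hβ, p, fun hc => ?_⟩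
  have hc' : ComputablePred fun x : ℕ => (F x).Dom := by
    refine hc.of_eq fun x => ?_
    rw [← hp (fun _ => x)]
    exact Part.dom_iff_mem.symm
  refine ComputablePred.halting_problem 0 ?_
  obtain ⟨hd, hcomp⟩ := hc'
  refine ComputablePred.of_eq (p := fun c : Nat.Partrec.Code => (F (Encodable.encode c)).Dom)
    ⟨fun c => hd _, hcomp.comp Computable.encode⟩ fun c => ?_
  simp [F]

end S13

namespace S13

open Nat Dioph

/-! ### From integer polynomials to pairs of coefficient functions -/

theorem poly_to_mv {α : Type} (p : Poly α) : ∃ P Q : MvPolynomial α ℕ, ∀ v : α → ℕ,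
    p v = (MvPolynomial.eval v P : ℤ) - (MvPolynomial.eval v Q : ℤ) := by
  induction p using Poly.induction with
  | H1 i => exact ⟨MvPolynomial.X i, 0, fun v => by simp⟩
  | H2 n =>
    refine ⟨MvPolynomial.C n.toNat, MvPolynomial.C (-n).toNat, fun v => ?_⟩
    simp only [Poly.const_apply, MvPolynomial.eval_C]
    omega
  | H3 f g hf hg =>
    obtain ⟨P, Q, h⟩ := hf
    obtain ⟨P', Q', h'⟩ := hg
    refine ⟨P + Q', Q + P', fun v => ?_⟩
    rw [Poly.sub_apply, h, h']
    simp only [map_add]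
    push_cast
    ring
  | H4 f g hf hg =>
    obtain ⟨P, Q, h⟩ := hf
    obtain ⟨P', Q', h'⟩ := hg
    refine ⟨P * P' + Q * Q', P * Q' + Q * P', fun v => ?_⟩
    rw [Poly.mul_apply, h, h']
    simp only [map_add, map_mul]
    push_cast
    ring

/-- monomial evaluation -/
def mon {n d : ℕ} (y : Fin n → ℕ) (e : Fin n → Fin (d + 1)) : ℕ := ∏ j, y j ^ (e j : ℕ)

/-- polynomial evaluation from a coefficient function -/
def pev {n d : ℕ} (c : (Fin n → Fin (d + 1)) → ℕ) (y : Fin n → ℕ) : ℕ := ∑ e, mon y e * c e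

theorem mv_to_pev {n : ℕ} (P : MvPolynomial (Fin n) ℕ) (d : ℕ) (hd : P.totalDegree ≤ d) :
    ∃ c : (Fin n → Fin (d + 1)) → ℕ, ∀ y, pev c y = MvPolynomial.eval y P := by
  classical
  let g : (Fin n → Fin (d + 1)) → (Fin n →₀ ℕ) := fun e =>
    Finsupp.equivFunOnFinite.symm (fun i => (e i : ℕ))
  have hg : Function.Injective g := by
    intro e e' h
    have h2 := Finsupp.equivFunOnFinite.symm.injective h
    funext i
    exact Fin.ext (congrFun h2 i)
  refine ⟨fun e => P.coeff (g e), fun y => ?_⟩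
  rw [MvPolynomial.eval_eq']
  have hs : P.support ⊆ Finset.univ.image g := by
    intro s hs
    have hle : ∀ i, s i < d + 1 := by
      intro i
      have h1 := MvPolynomial.le_totalDegree hs
      have h2 : s i ≤ s.sum fun _ e => e := by
        by_cases hi : i ∈ s.support
        · exact Finset.single_le_sum (f := fun i => s i) (fun _ _ => Nat.zero_le _) hi
        · simp [Finsupp.notMem_support_iff.1 hi]
      omega
    refine Finset.mem_image.2 ⟨fun i => ⟨s i, hle i⟩, Finset.mem_univ _, ?_⟩
    ext i
    simp [g]
  rw [Finset.sum_subset hs, Finset.sum_image fun a _ b _ h => hg h]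
  · refine Finset.sum_congr rfl fun e _ => ?_
    simp [mon, g, mul_comm]
  · intro s _ h
    rw [MvPolynomial.notMem_support_iff.1 h, zero_mul]

theorem exists_undecidable_pev : ∃ (m d : ℕ) (c : Bool → (Fin (m + 1) → Fin (d + 1)) → ℕ),
    (∀ b y, 0 < pev (c b) y) ∧
    ¬ ComputablePred fun x : ℕ => ∃ y : Fin (m + 1) → ℕ, y 0 = x ∧
      pev (c false) y = pev (c true) y := by
  obtain ⟨β, hβ, p, hp⟩ := exists_undecidable_poly
  obtain ⟨P, Q, hPQ⟩ := poly_to_mv p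
  let m := Fintype.card β
  let f : Unit ⊕ β → Fin (m + 1) := Sum.elim (fun _ => 0) (fun b => (Fintype.equivFin β b).succ)
  let P' := MvPolynomial.rename f P + 1
  let Q' := MvPolynomial.rename f Q + 1
  let d := max P'.totalDegree Q'.totalDegree
  obtain ⟨cP, hcP⟩ := mv_to_pev P' d (le_max_left _ _)
  obtain ⟨cQ, hcQ⟩ := mv_to_pev Q' d (le_max_right _ _)
  refine ⟨m, d, fun b => cond b cQ cP, ?_, fun hc => hp (hc.of_eq fun x => ?_)⟩
  · rintro (_ | _) y
    · simp [hcP, P']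
    · simp [hcQ, Q']
  · have key : ∀ y : Fin (m + 1) → ℕ, pev cP y = pev cQ y ↔ p (y ∘ f) = 0 := by
      intro y
      rw [hcP, hcQ, hPQ]
      simp only [P', Q', map_add, map_one, MvPolynomial.eval_rename]
      omega
    constructor
    · rintro ⟨y, rfl, h⟩
      refine ⟨fun b => y (Fintype.equivFin β b).succ, ?_⟩
      have h2 := (key y).1 h
      convert h2 using 2
      funext i
      rcases i with i | i <;> simp [f]
    · rintro ⟨t, ht⟩
      refine ⟨Fin.cons x (fun i => t ((Fintype.equivFin β).symm i)), by simp, ?_⟩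
      refine (key _).2 ?_
      convert ht using 2
      funext i
      rcases i with i | i <;> simp [f]

end S13

namespace S13

open Nat Dioph

/-! ### The matrices -/

/-- index type of the matrices -/
inductive St (n d : ℕ) : Type
  | s : St n d
  | r : Bool → St n d
  | v : Bool → Fin n → (Fin n → Fin (d + 1)) → St n d
  | t : St n d

/-- the index type as a sum -/
def stEquiv (n d : ℕ) :
    (Unit ⊕ Bool) ⊕ ((Bool × Fin n × (Fin n → Fin (d + 1))) ⊕ Unit) ≃ St n d where
  toFun
    | .inl (.inl _) => .s
    | .inl (.inr b) => .r b
    | .inr (.inl (b, l, e)) => .v b l e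
    | .inr (.inr _) => .t
  invFun
    | .s => .inl (.inl ())
    | .r b => .inl (.inr b)
    | .v b l e => .inr (.inl (b, l, e))
    | .t => .inr (.inr ())
  left_inv := by rintro ((_ | _) | (⟨_, _, _⟩ | _)) <;> rfl
  right_inv := by rintro (_ | _ | _ | _) <;> rfl

instance (n d : ℕ) : Fintype (St n d) := Fintype.ofEquiv _ (stEquiv n d)

noncomputable instance (n d : ℕ) : DecidableEq (St n d) := Classical.decEq _

theorem sum_st {n d : ℕ} (f : St n d → ℕ) : ∑ i, f i =
    (f .s + ∑ b, f (.r b)) + (∑ b, ∑ l, ∑ e, f (.v b l e) + f .t) := by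
  rw [← Equiv.sum_comp (stEquiv n d)]
  simp [Fintype.sum_sum_type, Fintype.sum_prod_type, stEquiv]

/-- one coordinate of the shift matrix -/
def shiftK {n d : ℕ} (l j : Fin n) (a b : Fin (d + 1)) : ℕ :=
  if j = l then Nat.choose b a else if a = b then 1 else 0

/-- the first matrix -/
def matF (n d : ℕ) : St n d → St n d → ℕ
  | .r false, .r true => 1
  | .v b l e, .v b' l' e' => if b = b' ∧ l = l' then ∏ j, shiftK l j (e j) (e' j) else 0
  | .t, .t => 1
  | _, _ => 0

/-- the second matrix -/
def matT {n d : ℕ} (c : Bool → (Fin n → Fin (d + 1)) → ℕ) : St n d → St n d → ℕ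
  | .s, .r false => 1
  | .r b, .v b' l e => if b = b' ∧ (l : ℕ) = 0 ∧ e = 0 then 1 else 0
  | .v b l e, .v b' l' e' => if b = b' ∧ (l' : ℕ) = l + 1 ∧ e = e' then 1 else 0
  | .v b l e, .t => if (l : ℕ) + 1 = n then c b e else 0
  | _, _ => 0

/-- both matrices -/
def mat {n d : ℕ} (c : Bool → (Fin n → Fin (d + 1)) → ℕ) (a : Bool) :
    Matrix (St n d) (St n d) ℕ :=
  Matrix.of (cond a (matT c) (matF n d))

/-- row vectors that occur -/
def vec {n d : ℕ} (c : Bool → (Fin n → Fin (d + 1)) → ℕ) (b : Bool) (l : ℕ) (x : Fin n → ℕ) :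
    St n d → ℕ
  | .v b' l' e => if b = b' ∧ l = l' then mon x e else 0
  | .t => if l = n then pev (c b) x else 0
  | _ => 0

/-- increment the `l`-th variable -/
def bump {n : ℕ} (l k : ℕ) (x : Fin n → ℕ) : Fin n → ℕ := fun j => if (j : ℕ) = l then x j + k else x j

theorem mon_shift {n d : ℕ} (x : Fin n → ℕ) (l : Fin n) (e : Fin n → Fin (d + 1)) :
    ∑ e', mon x e' * ∏ j, shiftK l j (e' j) (e j) = mon (bump l 1 x) e := by
  classical
  simp only [mon, ← Finset.prod_mul_distrib]
  have := Finset.prod_univ_sum (fun _ : Fin n => (Finset.univ : Finset (Fin (d + 1))))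
    (fun j a => x j ^ (a : ℕ) * shiftK l j a (e j))
  rw [Fintype.piFinset_univ] at this
  rw [← this]
  refine Finset.prod_congr rfl fun j _ => ?_
  by_cases h : j = l
  · subst h
    simp only [bump, shiftK, if_true]
    rw [add_pow, Fin.sum_univ_eq_sum_range (fun a => x j ^ a * Nat.choose (e j) a) (d + 1)]
    symm
    refine Finset.sum_subset_zero_on_sdiff ?_ ?_ ?_
    · intro a ha
      have := (e j).2
      simp only [Finset.mem_range] at *
      omega
    · intro a ha
      simp only [Finset.mem_sdiff, Finset.mem_range] at ha
      rw [Nat.choose_eq_zero_of_lt (by omega), mul_zero]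
    · intro a _
      simp
  · have h' : (j : ℕ) ≠ l := fun h' => h (Fin.ext h')
    simp [bump, shiftK, h, h']

theorem vec_false {n d : ℕ} (c : Bool → (Fin n → Fin (d + 1)) → ℕ) (b : Bool) (l : ℕ)
    (x : Fin n → ℕ) : Matrix.vecMul (vec c b l x) (mat c false) = vec c b l (bump l 1 x) := by
  funext j
  simp only [Matrix.vecMul, dotProduct, mat, cond_false, Matrix.of_apply]
  rw [sum_st]
  rcases j with _ | b' | ⟨b', l', e⟩ | _
  · simp [vec, matF]
  · simp [vec, matF]
  · simp only [vec, matF, mul_zero, zero_mul, add_zero, Finset.sum_const_zero, zero_add]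
    rw [Finset.sum_eq_single b']
    · rw [Finset.sum_eq_single l']
      · by_cases h : b = b' ∧ l = l'
        · obtain ⟨rfl, rfl⟩ := h
          simp [mon_shift]
        · simp [h]
      · intro q _ hq
        simp [hq]
      · simp
    · intro q _ hq
      simp [hq]
    · simp
  · simp only [vec, matF, mul_zero, zero_mul, add_zero, Finset.sum_const_zero, zero_add, mul_one]
    by_cases h : l = n
    · simp only [h, if_true]
      congr 1
      funext j
      have := j.2
      simp only [bump]
      rw [if_neg (by omega)]
    · simp [h]

theorem vec_true {n d : ℕ} (c : Bool → (Fin n → Fin (d + 1)) → ℕ) (b : Bool) (l : ℕ)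
    (x : Fin n → ℕ) : Matrix.vecMul (vec c b l x) (mat c true) = vec c b (l + 1) x := by
  classical
  funext j
  simp only [Matrix.vecMul, dotProduct, mat, cond_true, Matrix.of_apply]
  rw [sum_st]
  rcases j with _ | b' | ⟨b', l', e⟩ | _
  · simp [vec, matT]
  · simp [vec, matT]
  · simp only [vec, matT, mul_zero, zero_mul, add_zero, Finset.sum_const_zero, zero_add]
    rw [Finset.sum_eq_single b']
    · by_cases h : b = b' ∧ l + 1 = l'
      · obtain ⟨rfl, h⟩ := h
        have hl : l < n := by have := l'.2; omega
        rw [Finset.sum_eq_single ⟨l, hl⟩, Finset.sum_eq_single e]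
        · simp [h]
        · intro q _ hq
          simp [hq]
        · simp
        · intro q _ hq
          have hq' : l ≠ q := fun h => hq (Fin.ext h.symm)
          simp [hq']
        · simp
      · rw [if_neg h]
        refine Finset.sum_eq_zero fun q _ => Finset.sum_eq_zero fun e' _ => ?_
        by_cases h1 : b = b' ∧ l = q
        · have : ¬ ((l' : ℕ) = q + 1) := by
            intro h2
            exact h ⟨h1.1, by omega⟩
          simp [this]
        · simp [h1]
    · intro q _ hq
      simp [hq]
    · simp
  · simp only [vec, matT, mul_zero, zero_mul, add_zero, Finset.sum_const_zero, zero_add]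
    rw [Finset.sum_eq_single b]
    · by_cases h : l + 1 = n
      · rw [if_pos h, Finset.sum_eq_single ⟨l, by omega⟩]
        · simp [h, pev]
        · intro q _ hq
          have hq' : l ≠ q := fun h => hq (Fin.ext h.symm)
          simp [hq']
        · simp
      · rw [if_neg h]
        refine Finset.sum_eq_zero fun q _ => Finset.sum_eq_zero fun e' _ => ?_
        by_cases h1 : l = q
        · have : ¬ ((q : ℕ) + 1 = n) := by omega
          simp [this]
        · simp [h1]
    · intro q _ hq
      simp [hq.symm]
    · simp

/-- product of matrices along a word -/
noncomputable def word {n d : ℕ} (c : Bool → (Fin n → Fin (d + 1)) → ℕ) (w : List Bool) :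
    Matrix (St n d) (St n d) ℕ := (w.map (mat c)).prod

theorem word_cons {n d : ℕ} (c : Bool → (Fin n → Fin (d + 1)) → ℕ) (a : Bool) (w : List Bool) :
    word c (a :: w) = mat c a * word c w := by simp [word]

theorem word_append {n d : ℕ} (c : Bool → (Fin n → Fin (d + 1)) → ℕ) (w w' : List Bool) :
    word c (w ++ w') = word c w * word c w' := by simp [word]

theorem vec_word {n d : ℕ} (c : Bool → (Fin n → Fin (d + 1)) → ℕ) (w : List Bool) :
    ∀ (l : ℕ) (x : Fin n → ℕ), ∃ y : Fin n → ℕ, (∀ j : Fin n, (j : ℕ) < l → y j = x j) ∧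
      ∀ b, Matrix.vecMul (vec c b l x) (word c w) = vec c b (l + w.count true) y := by
  induction w with
  | nil => exact fun l x => ⟨x, fun _ _ => rfl, fun b => by simp [word]⟩
  | cons a w ih =>
    intro l x
    cases a
    · obtain ⟨y, h1, h2⟩ := ih l (bump l 1 x)
      refine ⟨y, fun j hj => ?_, fun b => ?_⟩
      · rw [h1 j hj, bump, if_neg (by omega)]
      · rw [word_cons, ← Matrix.vecMul_vecMul, vec_false, h2]
        simp
    · obtain ⟨y, h1, h2⟩ := ih (l + 1) x
      refine ⟨y, fun j hj => h1 j (by omega), fun b => ?_⟩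
      rw [word_cons, ← Matrix.vecMul_vecMul, vec_true, h2]
      congr 1
      simp
      ring

theorem vec_replicate {n d : ℕ} (c : Bool → (Fin n → Fin (d + 1)) → ℕ) (b : Bool) (l : ℕ)
    (k : ℕ) : ∀ x : Fin n → ℕ, Matrix.vecMul (vec c b l x) (word c (List.replicate k false)) =
      vec c b l (bump l k x) := by
  induction k with
  | zero =>
    intro x
    have : bump l 0 x = x := by funext j; simp [bump]
    simp [word, this]
  | succ k ih =>
    intro x
    rw [List.replicate_succ, word_cons, ← Matrix.vecMul_vecMul, vec_false, ih]
    congr 1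
    funext j
    simp only [bump]
    split_ifs <;> omega

theorem exists_word {n d : ℕ} (c : Bool → (Fin n → Fin (d + 1)) → ℕ) (y : Fin n → ℕ) (k : ℕ) :
    ∀ (l : ℕ) (x : Fin n → ℕ), l + k = n → (∀ j : Fin n, (j : ℕ) < l → x j = y j) →
      (∀ j : Fin n, l ≤ (j : ℕ) → x j = 0) →
      ∃ w : List Bool, w.count true = k ∧
        ∀ b, Matrix.vecMul (vec c b l x) (word c w) = vec c b n y := by
  induction k with
  | zero =>
    intro l x hl h1 _
    have : x = y := funext fun j => h1 j (by have := j.2; omega)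
    exact ⟨[], rfl, fun b => by simp [word, this, ← hl]⟩
  | succ k ih =>
    intro l x hl h1 h2
    have hln : l < n := by omega
    obtain ⟨w, hw, hw2⟩ := ih (l + 1) (bump l (y ⟨l, hln⟩) x) (by omega) (by
      intro j hj
      simp only [bump]
      split_ifs with h
      · have : j = ⟨l, hln⟩ := Fin.ext h
        rw [h2 j (by omega), this, zero_add]
      · exact h1 j (by omega)) (by
      intro j hj
      simp only [bump]
      rw [if_neg (by omega)]
      exact h2 j (by omega))
    refine ⟨List.replicate (y ⟨l, hln⟩) false ++ true :: w, ?_, fun b => ?_⟩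
    · simp [hw, List.count_replicate]
    · rw [word_append, word_cons, ← Matrix.vecMul_vecMul, vec_replicate, ← Matrix.vecMul_vecMul,
        vec_true, hw2]

/-- level of a state -/
def level {n d : ℕ} : St n d → ℕ
  | .s => 0
  | .r _ => 1
  | .v _ l _ => l + 2
  | .t => n + 2

theorem level_le {n d : ℕ} (i : St n d) : level i ≤ n + 2 := by
  rcases i with _ | _ | ⟨_, l, _⟩ | _ <;> simp [level]

theorem level_mat {n d : ℕ} (c : Bool → (Fin n → Fin (d + 1)) → ℕ) (a : Bool) (i j : St n d)
    (h : mat c a i j ≠ 0) : level j = level i + if a = true then 1 else 0 := by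
  cases a
  · rcases i with _ | (_ | _) | ⟨b, l, e⟩ | _ <;> rcases j with _ | (_ | _) | ⟨b', l', e'⟩ | _ <;>
      simp [mat, matF, level] at h ⊢
    rw [h.2.1]
  · rcases i with _ | (_ | _) | ⟨b, l, e⟩ | _ <;> rcases j with _ | (_ | _) | ⟨b', l', e'⟩ | _ <;>
      simp [mat, matT, level] at h ⊢ <;> omega

theorem level_word {n d : ℕ} (c : Bool → (Fin n → Fin (d + 1)) → ℕ) (w : List Bool) :
    ∀ i j : St n d, word c w i j ≠ 0 → level j = level i + w.count true := by
  induction w with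
  | nil =>
    intro i j h
    have : i = j := by
      by_contra hij
      exact h (by simp [word, hij])
    simp [this]
  | cons a w ih =>
    intro i j h
    rw [word_cons, Matrix.mul_apply] at h
    obtain ⟨k, _, hk⟩ := Finset.exists_ne_zero_of_sum_ne_zero h
    have h1 := level_mat c a i k (left_ne_zero_of_mul hk)
    have h2 := ih k j (right_ne_zero_of_mul hk)
    rw [h2, h1, List.count_cons]
    cases a <;> simp
    ring

/-- secondary rank of a state -/
def subrank {n d : ℕ} : St n d → ℕ
  | .s => 0
  | .r b => cond b 1 0
  | .v _ _ e => ∑ j, (e j : ℕ)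
  | .t => 0

/-- rank of a state, for triangularity -/
def rank {n d : ℕ} (i : St n d) : ℕ ×ₗ ℕ := toLex (level i, subrank i)

theorem rank_mat {n d : ℕ} (c : Bool → (Fin n → Fin (d + 1)) → ℕ) (a : Bool) (i j : St n d)
    (h : mat c a i j ≠ 0) : i = j ∨ rank i < rank j := by
  have hl := level_mat c a i j h
  cases a
  · simp only [Bool.false_eq_true, if_false, add_zero] at hl
    by_cases hij : i = j
    · exact Or.inl hij
    refine Or.inr ?_
    rw [rank, rank, Prod.Lex.toLex_lt_toLex]
    refine Or.inr ⟨hl.symm, ?_⟩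
    rcases i with _ | (_ | _) | ⟨b, l, e⟩ | _ <;> rcases j with _ | (_ | _) | ⟨b', l', e'⟩ | _ <;>
      simp [mat, matF, subrank] at h hij ⊢
    obtain ⟨rfl, rfl, h⟩ := h
    have h' : ∏ q, shiftK l q (e q) (e' q) ≠ 0 := by
      rw [Finset.prod_ne_zero_iff]
      simpa [Finset.prod_eq_zero_iff] using h
    have hle : ∀ q, (e q : ℕ) ≤ e' q := by
      intro q
      have hq := (Finset.prod_ne_zero_iff.1 h') q (Finset.mem_univ _)
      simp only [shiftK] at hq
      split_ifs at hq with h1 h2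
      · by_contra hlt
        exact hq (Nat.choose_eq_zero_of_lt (by omega))
      · rw [h2]
      · exact absurd rfl hq
    refine Finset.sum_lt_sum (fun q _ => hle q) ?_
    by_contra hcon
    push Not at hcon
    refine hij rfl rfl (funext fun q => Fin.ext (le_antisymm (hle q) (hcon q (Finset.mem_univ _))))
  · refine Or.inr ?_
    rw [rank, rank, Prod.Lex.toLex_lt_toLex]
    left
    simp at hl ⊢
    omega

end S13

namespace S13

open Nat Dioph

/-- first word -/
def wU (x : ℕ) : List Bool := true :: true :: (List.replicate x false ++ [true])

/-- second word -/
def wV (x : ℕ) : List Bool := true :: false :: true :: (List.replicate x false ++ [true])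

/-- input vector -/
def inp (m x : ℕ) : Fin (m + 1) → ℕ := bump 0 x 0

theorem single_s {n d : ℕ} (c : Bool → (Fin n → Fin (d + 1)) → ℕ) :
    Matrix.vecMul (Pi.single St.s 1) (mat c true) = Pi.single (St.r false) 1 := by
  rw [Matrix.single_one_vecMul]
  funext j
  rcases j with _ | (_ | _) | _ | _ <;> simp [mat, matT, Pi.single_apply]

theorem single_r {n d : ℕ} (c : Bool → (Fin n → Fin (d + 1)) → ℕ) :
    Matrix.vecMul (Pi.single (St.r false) 1) (mat c false) = Pi.single (St.r true) 1 := by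
  rw [Matrix.single_one_vecMul]
  funext j
  rcases j with _ | (_ | _) | _ | _ <;> simp [mat, matF, Pi.single_apply]

theorem mon_zero {n d : ℕ} (e : Fin n → Fin (d + 1)) :
    mon 0 e = if e = 0 then 1 else 0 := by
  simp only [mon, Pi.zero_apply]
  split_ifs with h
  · simp [h]
  · obtain ⟨q, hq⟩ := Function.ne_iff.1 h
    refine Finset.prod_eq_zero (Finset.mem_univ q) (zero_pow ?_)
    intro h0
    exact hq (Fin.ext h0)

theorem single_rb {m d : ℕ} (c : Bool → (Fin (m + 1) → Fin (d + 1)) → ℕ) (b : Bool) :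
    Matrix.vecMul (Pi.single (St.r b) 1) (mat c true) = vec c b 0 0 := by
  rw [Matrix.single_one_vecMul]
  funext j
  rcases j with _ | _ | ⟨b', l, e⟩ | _
  · simp [mat, matT, vec]
  · simp [mat, matT, vec]
  · simp only [Matrix.row, mat, matT, vec, cond_true, Matrix.of_apply, mon_zero]
    by_cases h1 : b = b' <;> by_cases h2 : (l : ℕ) = 0 <;> by_cases h3 : e = 0 <;>
      simp [h1, h2, h3, eq_comm]
  · simp [mat, matT, vec]

theorem row_U {m d : ℕ} (c : Bool → (Fin (m + 1) → Fin (d + 1)) → ℕ) (x : ℕ) :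
    Matrix.vecMul (Pi.single St.s 1) (word c (wU x)) = vec c false 1 (inp m x) := by
  rw [wU, word_cons, ← Matrix.vecMul_vecMul, single_s, word_cons, ← Matrix.vecMul_vecMul,
    single_rb, word_append, ← Matrix.vecMul_vecMul, vec_replicate, word_cons,
    ← Matrix.vecMul_vecMul, vec_true]
  simp [word, inp]

theorem row_V {m d : ℕ} (c : Bool → (Fin (m + 1) → Fin (d + 1)) → ℕ) (x : ℕ) :
    Matrix.vecMul (Pi.single St.s 1) (word c (wV x)) = vec c true 1 (inp m x) := by
  rw [wV, word_cons, ← Matrix.vecMul_vecMul, single_s, word_cons, ← Matrix.vecMul_vecMul,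
    single_r, word_cons, ← Matrix.vecMul_vecMul,
    single_rb, word_append, ← Matrix.vecMul_vecMul, vec_replicate, word_cons,
    ← Matrix.vecMul_vecMul, vec_true]
  simp [word, inp]

theorem count_U (x : ℕ) : (wU x).count true = 3 := by simp [wU, List.count_replicate]

theorem count_V (x : ℕ) : (wV x).count true = 3 := by simp [wV, List.count_replicate]

theorem core {m d : ℕ} (c : Bool → (Fin (m + 1) → Fin (d + 1)) → ℕ)
    (hc : ∀ b y, 0 < pev (c b) y) (x : ℕ) :
    (∃ w, word c (wU x) * word c w = word c (wV x) * word c w ∧ word c (wU x) * word c w ≠ 0) ↔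
    ∃ y : Fin (m + 1) → ℕ, y 0 = x ∧ pev (c false) y = pev (c true) y := by
  have rU : ∀ w, Matrix.vecMul (Pi.single St.s 1) (word c (wU x) * word c w) =
      Matrix.vecMul (vec c false 1 (inp m x)) (word c w) := fun w => by
    rw [← Matrix.vecMul_vecMul, row_U]
  have rV : ∀ w, Matrix.vecMul (Pi.single St.s 1) (word c (wV x) * word c w) =
      Matrix.vecMul (vec c true 1 (inp m x)) (word c w) := fun w => by
    rw [← Matrix.vecMul_vecMul, row_V]
  constructor
  · rintro ⟨w, h1, h2⟩
    obtain ⟨y, hy, hw⟩ := vec_word c w 1 (inp m x)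
    refine ⟨y, by rw [hy 0 (by simp)]; simp [inp, bump], ?_⟩
    have h3 : vec c false (1 + w.count true) y = vec c true (1 + w.count true) y := by
      rw [← hw, ← hw, ← rU, ← rV, h1]
    have hlev : w.count true ≤ m := by
      by_contra hcon
      apply h2
      rw [← word_append]
      ext i j
      by_contra h4
      have h5 := level_word c _ i j h4
      have h6 := level_le j
      rw [List.count_append, count_U] at h5
      omega
    rcases hlev.lt_or_eq with hlt | heq
    · exfalso
      have h4 := congrFun h3 (St.v false ⟨1 + w.count true, by omega⟩ 0)
      simp [vec, mon] at h4
    · have h4 := congrFun h3 St.t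
      simpa [vec, heq, add_comm] using h4
  · rintro ⟨y, hy0, hy⟩
    obtain ⟨w, hw, hw2⟩ := exists_word c y m 1 (inp m x) (by omega) (by
      intro j hj
      have : j = 0 := Fin.ext (by simpa using hj)
      rw [this, hy0]
      simp [inp, bump]) (by
      intro j hj
      simp only [inp, bump]
      rw [if_neg (by omega)]
      rfl)
    have hv : vec c false (m + 1) y = vec c true (m + 1) y := by
      funext j
      rcases j with _ | _ | ⟨b, l, e⟩ | _
      · rfl
      · rfl
      · have : m + 1 ≠ (l : ℕ) := by have := l.2; omega
        simp [vec, this]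
      · simp [vec, hy]
    refine ⟨w, ?_, ?_⟩
    · ext i j
      by_cases hi : i = St.s
      · subst hi
        have h1 := congrFun (rU w) j
        have h2 := congrFun (rV w) j
        rw [hw2, Matrix.single_one_vecMul] at h1 h2
        rw [hv] at h1
        exact h1.trans h2.symm
      · have hi' : 0 < level i := by
          rcases i with _ | _ | _ | _ <;> simp [level] at hi ⊢
        have hz : ∀ w', w'.count true = 3 → (word c w' * word c w) i j = 0 := by
          intro w' hw'
          rw [← word_append]
          by_contra h4
          have h5 := level_word c _ i j h4
          have h6 := level_le j
          rw [List.count_append, hw', hw] at h5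
          omega
        rw [hz _ (count_U x), hz _ (count_V x)]
    · intro h0
      have h1 := congrFun (rU w) St.t
      rw [hw2, h0] at h1
      have := hc false y
      simp [vec] at h1
      omega

theorem primrec_replicate : Primrec fun x : ℕ => List.replicate x false := by
  have := Primrec.nat_rec' (f := fun x : ℕ => x) (g := fun _ : ℕ => ([] : List Bool))
    (h := fun _ p => false :: p.2) Primrec.id (Primrec.const _)
    (Primrec.list_cons.comp (Primrec.const false) (Primrec.snd.comp Primrec.snd)).to₂
  refine this.of_eq fun x => ?_
  induction x with
  | zero => rfl
  | succ k ih => rw [List.replicate_succ, ← ih]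

theorem primrec_words : Primrec fun x : ℕ => (wU x, wV x) := by
  have h : Primrec fun x : ℕ => List.replicate x false ++ [true] :=
    Primrec.list_append.comp primrec_replicate (Primrec.const _)
  have hc : ∀ (b : Bool) {f : ℕ → List Bool}, Primrec f → Primrec fun x => b :: f x :=
    fun b _ hf => Primrec.list_cons.comp (Primrec.const b) hf
  exact (hc _ (hc _ h)).pair (hc _ (hc _ (hc _ h)))

theorem exists_order {ι : Type} [Fintype ι] {L : Type} [LinearOrder L] (ρ : ι → L) :
    ∃ e : ι ≃ Fin (Fintype.card ι), ∀ i j, ρ i < ρ j → e i < e j := by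
  let e0 := Fintype.equivFin ι
  let σ := Tuple.sort (ρ ∘ e0.symm)
  have hm : Monotone ((ρ ∘ e0.symm) ∘ σ) := Tuple.monotone_sort _
  refine ⟨e0.trans σ.symm, fun i j h => ?_⟩
  by_contra hcon
  have := hm (not_lt.1 hcon)
  simp at this
  exact absurd h (not_lt.2 this)

end S13

/-- undecidability of the existence of a nonannihilating solution of
`a x = b x` over the monoid generated by two upper triangular matrices with
nonnegative integer entries; `φ` is the monoid homomorphism from the free monoid on
two letters sending the first letter to `M1` and the second to `M2`. -/
theorem statement13 :
    ∃ (k : ℕ) (M1 M2 : Matrix (Fin k) (Fin k) ℕ),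
      0 < k ∧ MatrixUpperTriangular M1 ∧ MatrixUpperTriangular M2 ∧
      ∀ φ : FreeMonoid Bool →* Matrix (Fin k) (Fin k) ℕ,
        φ (FreeMonoid.of false) = M1 →
        φ (FreeMonoid.of true) = M2 →
        ¬ ComputablePred (fun uv : List Bool × List Bool =>
          ∃ N ∈ Submonoid.closure ({M1, M2} : Set (Matrix (Fin k) (Fin k) ℕ)),
            φ (FreeMonoid.ofList uv.1) * N = φ (FreeMonoid.ofList uv.2) * N ∧
            φ (FreeMonoid.ofList uv.1) * N ≠ 0) := by
  obtain ⟨m, d, c, hc, hund⟩ := S13.exists_undecidable_pev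
  obtain ⟨e, he⟩ := S13.exists_order (S13.rank : S13.St (m + 1) d → _)
  let R := Matrix.reindexRingEquiv ℕ e
  have htri : ∀ a, MatrixUpperTriangular (R (S13.mat c a)) := by
    intro a i j hij
    by_contra h
    have h1 : S13.mat c a (e.symm i) (e.symm j) ≠ 0 := h
    rcases S13.rank_mat c a _ _ h1 with h2 | h2
    · exact absurd (e.symm.injective h2) hij.ne'
    · have h3 := he _ _ h2
      simp only [Equiv.apply_symm_apply] at h3
      exact absurd h3 hij.asymm
  refine ⟨_, R (S13.mat c false), R (S13.mat c true),
    Fintype.card_pos_iff.2 ⟨S13.St.s⟩, htri _, htri _, fun φ h1 h2 hcomp => hund ?_⟩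
  have hφ : ∀ w : List Bool, φ (FreeMonoid.ofList w) = R (S13.word c w) := by
    intro w
    induction w with
    | nil => simp [S13.word]
    | cons a w ih =>
      rw [FreeMonoid.ofList_cons, map_mul, ih, S13.word_cons, map_mul]
      cases a
      · rw [h1]
      · rw [h2]
  have hN : ∀ N, N ∈ Submonoid.closure ({R (S13.mat c false), R (S13.mat c true)} :
      Set (Matrix (Fin _) (Fin _) ℕ)) ↔ ∃ w, N = R (S13.word c w) := by
    intro N
    constructor
    · intro h
      induction h using Submonoid.closure_induction with
      | mem x hx =>
        rcases hx with rfl | rfl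
        · exact ⟨[false], by simp [S13.word]⟩
        · exact ⟨[true], by simp [S13.word]⟩
      | one => exact ⟨[], by simp [S13.word]⟩
      | mul x y _ _ hx hy =>
        obtain ⟨w, rfl⟩ := hx
        obtain ⟨w', rfl⟩ := hy
        exact ⟨w ++ w', by rw [S13.word_append, map_mul]⟩
    · rintro ⟨w, rfl⟩
      induction w with
      | nil => simp [S13.word]
      | cons a w ih =>
        rw [S13.word_cons, map_mul]
        refine mul_mem (Submonoid.subset_closure ?_) ih
        cases a <;> simp
  obtain ⟨hd, hcmp⟩ := hcomp
  refine ComputablePred.of_eq ⟨fun x => hd (S13.wU x, S13.wV x),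
    hcmp.comp S13.primrec_words.to_comp⟩ fun x => ?_
  rw [← S13.core c hc x]
  simp only [hφ]
  constructor
  · rintro ⟨N, hNm, h3, h4⟩
    obtain ⟨w, rfl⟩ := (hN N).1 hNm
    rw [← map_mul] at h3 h4
    rw [← map_mul] at h3
    exact ⟨w, R.injective h3, fun h => h4 (by rw [h, map_zero])⟩
  · rintro ⟨w, h3, h4⟩
    refine ⟨_, (hN _).2 ⟨w, rfl⟩, ?_, ?_⟩
    · rw [← map_mul, ← map_mul, h3]
    · rw [← map_mul]
      exact fun h => h4 (R.injective (by rw [h, map_zero]))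
end
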